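/- arXiv:2512.20767 — 5 statements merged into one kernel-verified Lean document; each statement's English description precedes it below -/
import Mathlib

section
/- Let d ≥ 2 and let a = a_1 be the first free generator of F_d. Let g ∈ F_d with |g| ≥ 2 such that the reduced word of g neither begins nor ends with a_1 or a_1^{-1}. Then the subgroup Γ' = ⟨a_1, g a_1 g^{-1}⟩ of F_d satisfies 1/|g| ≤ δ(Γ') ≤ 1/√|g|. -/
open Filter

/-- The number of elements of `Γ` of word length at most `R`. -/
noncomputable def growthCount {d : ℕ} (Γ : Subgroup (FreeGroup (Fin d))) (R : ℕ) : ℕ :=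
  Nat.card {g : FreeGroup (Fin d) // g ∈ Γ ∧ FreeGroup.norm g ≤ R}

/-- The critical exponent `δ(Γ) = limsup_R log(c_Γ(R))/R`. -/
noncomputable def critExp {d : ℕ} (Γ : Subgroup (FreeGroup (Fin d))) : ℝ :=
  Filter.atTop.limsup fun R : ℕ => Real.log (growthCount Γ R : ℝ) / (R : ℝ)

/-- Chabauty convergence of a sequence of subgroups. -/
def ChabautyTendsto {G : Type*} [Group G] (H : ℕ → Subgroup G) (L : Subgroup G) : Prop :=
  ∀ g : G, ∀ᶠ n in Filter.atTop, (g ∈ H n ↔ g ∈ L)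

/-- A boomerang subgroup. -/
def IsBoomerang {G : Type*} [Group G] (Δ : Subgroup G) : Prop :=
  ∀ g : G, ∃ n : ℕ → ℕ, StrictMono n ∧
    ChabautyTendsto (fun k => Subgroup.map (MulAut.conj (g ^ n k)).toMonoidHom Δ) Δ


namespace ConjGen

open FreeGroup

/-- A connecting word: nonempty, reduced, neither beginning nor ending with the letter `z`. -/
def Good {α : Type*} (z : α) (X : List (α × Bool)) : Prop :=
  X ≠ [] ∧ IsReduced X ∧ (∀ l ∈ X.head?, l.1 ≠ z) ∧ (∀ l ∈ X.getLast?, l.1 ≠ z)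

lemma Good.cons {α : Type*} {z : α} {X : List (α × Bool)} (h : Good z X) (s : Bool) :
    IsReduced ((z, s) :: X) := by
  unfold FreeGroup.IsReduced
  rw [List.isChain_cons]
  exact ⟨fun y hy e => absurd e.symm (h.2.2.1 y hy), h.2.1⟩

lemma Good.append {α : Type*} {z : α} {X Y : List (α × Bool)} (h : Good z X) (s : Bool)
    (hY : IsReduced ((z, s) :: Y)) : IsReduced (X ++ (z, s) :: Y) := by
  unfold FreeGroup.IsReduced
  rw [List.isChain_append]
  refine ⟨h.2.1, hY, fun x hx y hy e => ?_⟩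
  simp only [List.head?_cons, Option.mem_def, Option.some.injEq] at hy
  subst hy
  exact absurd e (h.2.2.2 x hx)

lemma Good.cons_append {α : Type*} {z : α} {X Y : List (α × Bool)} (h : Good z X) (s s' : Bool)
    (hY : IsReduced ((z, s) :: Y)) : IsReduced ((z, s') :: (X ++ (z, s) :: Y)) := by
  unfold FreeGroup.IsReduced
  rw [List.isChain_cons]
  refine ⟨fun y hy e => ?_, h.append s hY⟩
  rw [List.head?_append_of_ne_nil _ h.1] at hy
  exact absurd e.symm (h.2.2.1 y hy)

lemma Good.invRev {α : Type*} {z : α} {X : List (α × Bool)} (h : Good z X) :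
    Good z (invRev X) := by
  classical
  obtain ⟨h1, h2, h3, h4⟩ := h
  refine ⟨by simpa [FreeGroup.invRev] using h1, ?_, ?_, ?_⟩
  · rw [isReduced_iff_reduce_eq, reduce_invRev, h2.reduce_eq]
  · intro l hl
    simp only [FreeGroup.invRev, List.head?_reverse, List.getLast?_map, Option.mem_def,
      Option.map_eq_some_iff] at hl
    obtain ⟨a, ha, rfl⟩ := hl
    exact h4 a ha
  · intro l hl
    simp only [FreeGroup.invRev, List.getLast?_reverse, List.head?_map, Option.mem_def,
      Option.map_eq_some_iff] at hl
    obtain ⟨a, ha, rfl⟩ := hl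
    exact h3 a ha

/-- Expansion of a word in `a` (`true`) and `g a g⁻¹` (`false`). -/
def expand {α : Type*} (z : α) (G : List (α × Bool)) :
    Bool → List (Bool × Bool) → List (α × Bool)
  | c, [] => if c then [] else FreeGroup.invRev G
  | c, l :: L => (if c = l.1 then [] else if c then G else FreeGroup.invRev G) ++
      (z, l.2) :: expand z G l.1 L

/-- Length of the expansion. -/
def wt (k : ℕ) : Bool → List (Bool × Bool) → ℕ
  | c, [] => if c then 0 else k
  | c, l :: L => (if c = l.1 then 0 else k) + 1 + wt k l.1 L

lemma length_expand {α : Type*} (z : α) (G : List (α × Bool)) (L : List (Bool × Bool)) :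
    ∀ c, (expand z G c L).length = wt G.length c L := by
  induction L with
  | nil => intro c; cases c <;> simp [expand, wt]
  | cons l L ih =>
    intro c
    simp only [expand, wt, List.length_append, List.length_cons, ih]
    split_ifs <;> (try simp only [List.length_nil, FreeGroup.invRev_length]) <;> omega

lemma expand_reduced_aux {α : Type*} {z : α} {G : List (α × Bool)} (hG : Good z G)
    (L : List (Bool × Bool)) :
    ∀ l : Bool × Bool, IsReduced (l :: L) → IsReduced ((z, l.2) :: expand z G l.1 L) := by
  induction L with
  | nil =>
    rintro ⟨c, s⟩ -
    cases c
    · simpa [expand] using hG.invRev.cons s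
    · simp [expand]
  | cons l' L ih =>
    rintro ⟨c, s⟩ h
    obtain ⟨c', s'⟩ := l'
    have h' := h
    unfold FreeGroup.IsReduced at h'
    rw [List.isChain_cons_cons] at h'
    have := ih _ h'.2
    simp only [expand]
    split_ifs with h1 h2
    · simp only [List.nil_append]
      unfold FreeGroup.IsReduced
      rw [List.isChain_cons_cons]
      exact ⟨fun _ => h'.1 h1, this⟩
    · exact hG.cons_append _ _ this
    · exact hG.invRev.cons_append _ _ this

lemma expand_reduced {α : Type*} {z : α} {G : List (α × Bool)} (hG : Good z G)
    (L : List (Bool × Bool)) (h : IsReduced L) : IsReduced (expand z G true L) := by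
  cases L with
  | nil => simp [expand]
  | cons l L =>
    have := expand_reduced_aux hG L l h
    simp only [expand]
    split_ifs with h1
    · simpa using this
    · exact hG.append _ this


/-- The map from the free group on two generators. -/
def phi {α : Type*} (z : α) (g : FreeGroup α) : FreeGroup Bool →* FreeGroup α :=
  FreeGroup.lift fun c => if c then FreeGroup.of z else g * FreeGroup.of z * g⁻¹

lemma mk_expand {α : Type*} [DecidableEq α] (z : α) (g : FreeGroup α) (L : List (Bool × Bool)) :
    ∀ c, FreeGroup.mk (expand z g.toWord c L) = (if c then 1 else g⁻¹) * phi z g (mk L) := by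
  have hgi : FreeGroup.mk (FreeGroup.invRev g.toWord) = g⁻¹ := by
    rw [← FreeGroup.inv_mk, mk_toWord]
  have hz : ∀ (s : Bool) (X : List (α × Bool)), FreeGroup.mk ((z, s) :: X) =
      cond s (FreeGroup.of z) (FreeGroup.of z)⁻¹ * mk X := by
    intro s X
    cases s
    · rw [of, inv_mk, cond_false, mul_mk]; rfl
    · rw [of, cond_true, mul_mk]; rfl
  induction L with
  | nil =>
    intro c
    have : (mk ([] : List (Bool × Bool))) = 1 := rfl
    have h2 : (mk ([] : List (α × Bool))) = 1 := rfl
    cases c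
    · simp [expand, hgi, this]
    · simp [expand, this, h2]
  | cons l L ih =>
    intro c
    obtain ⟨c', s⟩ := l
    have e : phi z g (mk ((c', s) :: L)) =
      (cond s (if c' then FreeGroup.of z else g * FreeGroup.of z * g⁻¹)
        (if c' then FreeGroup.of z else g * FreeGroup.of z * g⁻¹)⁻¹) * phi z g (mk L) := by
      simp only [phi, lift_mk, List.map_cons, List.prod_cons]
    rw [e]
    simp only [expand, ← mul_mk, hz, ih]
    have h2 : (mk ([] : List (α × Bool))) = 1 := rfl
    cases c <;> cases c' <;> cases s <;> simp [hgi, h2, mk_toWord, mul_assoc]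

lemma good_toWord {α : Type*} [DecidableEq α] {z : α} {g : FreeGroup α} (h : g ≠ 1)
    (h1 : ∀ l ∈ g.toWord.head?, l.1 ≠ z) (h2 : ∀ l ∈ g.toWord.getLast?, l.1 ≠ z) :
    Good z g.toWord :=
  ⟨by simpa [toWord_eq_nil_iff] using h, isReduced_toWord, h1, h2⟩

lemma toWord_phi {α : Type*} [DecidableEq α] {z : α} {g : FreeGroup α} (hG : Good z g.toWord)
    (w : FreeGroup Bool) : (phi z g w).toWord = expand z g.toWord true w.toWord := by
  have := mk_expand z g w.toWord true
  rw [mk_toWord] at this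
  simp only [if_true, one_mul] at this
  rw [← this, toWord_mk, (expand_reduced hG _ isReduced_toWord).reduce_eq]

lemma norm_phi {α : Type*} [DecidableEq α] {z : α} {g : FreeGroup α} (hG : Good z g.toWord)
    (w : FreeGroup Bool) : (phi z g w).norm = wt g.norm true w.toWord := by
  rw [FreeGroup.norm, toWord_phi hG, length_expand]; rfl

lemma phi_injective {α : Type*} [DecidableEq α] {z : α} {g : FreeGroup α}
    (hG : Good z g.toWord) : Function.Injective (phi z g) := by
  rw [injective_iff_map_eq_one]
  intro w hw
  have h := norm_phi hG w
  rw [hw, FreeGroup.norm_one] at h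
  rw [← toWord_eq_nil_iff]
  cases hL : w.toWord with
  | nil => rfl
  | cons l L => rw [hL] at h; simp only [wt] at h; omega

lemma range_phi {α : Type*} (z : α) (g : FreeGroup α) :
    (phi z g).range = Subgroup.closure {FreeGroup.of z, g * FreeGroup.of z * g⁻¹} := by
  rw [phi, FreeGroup.range_lift_eq_closure]
  congr 1
  rw [Bool.range_eq]
  simp [Set.pair_comm]

/-- Reduced continuations of a letter with bounded weight. -/
def S (k : ℕ) (l : Bool × Bool) (R : ℤ) : Set (List (Bool × Bool)) :=
  {L | IsReduced (l :: L) ∧ (wt k l.1 L : ℤ) ≤ R}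

/-- Reduced words with bounded weight. -/
def T (k : ℕ) (R : ℕ) : Set (List (Bool × Bool)) :=
  {L | IsReduced L ∧ wt k true L ≤ R}

lemma growthCount_eq {d : ℕ} {z : Fin d} {g : FreeGroup (Fin d)} (hG : Good z g.toWord) (R : ℕ) :
    growthCount (Subgroup.closure {FreeGroup.of z, g * FreeGroup.of z * g⁻¹}) R =
      (T g.norm R).ncard := by
  rw [← range_phi]
  have h1 : growthCount (phi z g).range R =
    ({x | x ∈ (phi z g).range ∧ x.norm ≤ R} : Set (FreeGroup (Fin d))).ncard := rfl
  have h2 : {x | x ∈ (phi z g).range ∧ x.norm ≤ R} =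
      phi z g '' {w | wt g.norm true w.toWord ≤ R} := by
    ext x
    simp only [Set.mem_ofPred_eq, Set.mem_image, MonoidHom.mem_range]
    constructor
    · rintro ⟨⟨w, rfl⟩, h⟩
      exact ⟨w, by rwa [← norm_phi hG], rfl⟩
    · rintro ⟨w, h, rfl⟩
      exact ⟨⟨w, rfl⟩, by rwa [norm_phi hG]⟩
  have h3 : T g.norm R = FreeGroup.toWord '' {w | wt g.norm true w.toWord ≤ R} := by
    ext L
    simp only [T, Set.mem_ofPred_eq, Set.mem_image]
    constructor
    · rintro ⟨hL, h⟩
      have : (mk L).toWord = L := by rw [toWord_mk, hL.reduce_eq]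
      exact ⟨mk L, by rwa [this], this⟩
    · rintro ⟨w, h, rfl⟩
      exact ⟨isReduced_toWord, h⟩
  rw [h1, h2, h3, Set.ncard_image_of_injective _ (phi_injective hG),
    Set.ncard_image_of_injective _ toWord_injective]

lemma length_le_wt (k : ℕ) (L : List (Bool × Bool)) : ∀ c, L.length ≤ wt k c L := by
  induction L with
  | nil => intro c; simp
  | cons l L ih => intro c; have := ih l.1; simp only [wt, List.length_cons]; omega

lemma S_finite (k : ℕ) (l : Bool × Bool) (R : ℤ) : (S k l R).Finite := by
  refine (List.finite_length_le (Bool × Bool) R.toNat).subset ?_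
  rintro L ⟨-, h⟩
  have := length_le_wt k L l.1
  simp only [Set.mem_ofPred_eq]; omega

lemma T_finite (k : ℕ) (R : ℕ) : (T k R).Finite := by
  refine (List.finite_length_le (Bool × Bool) R).subset ?_
  rintro L ⟨-, h⟩
  exact (length_le_wt k L true).trans h

lemma S_subset (k : ℕ) (c s : Bool) (R : ℤ) : S k (c, s) R ⊆
    {[]} ∪ (List.cons (c, s) '' S k (c, s) (R - 1)) ∪
      (List.cons (!c, true) '' S k (!c, true) (R - 1 - k)) ∪
      (List.cons (!c, false) '' S k (!c, false) (R - 1 - k)) := by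
  rintro L ⟨h1, h2⟩
  rcases L with _ | ⟨⟨c', s'⟩, L⟩
  · simp
  · have h1' := h1
    unfold FreeGroup.IsReduced at h1'
    rw [List.isChain_cons_cons] at h1'
    obtain ⟨h3, h4⟩ := h1'
    simp only [wt] at h2
    by_cases hc : c = c'
    · obtain rfl := hc
      obtain rfl : s = s' := h3 rfl
      refine Or.inl (Or.inl (Or.inr ⟨L, ⟨h4, ?_⟩, rfl⟩))
      simp at h2 ⊢; omega
    · obtain rfl : c' = !c := by cases c <;> cases c' <;> simp_all
      rw [if_neg hc] at h2
      cases s'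
      · refine Or.inr ⟨L, ⟨h4, ?_⟩, rfl⟩
        push_cast at h2 ⊢; omega
      · refine Or.inl (Or.inr ⟨L, ⟨h4, ?_⟩, rfl⟩)
        push_cast at h2 ⊢; omega

lemma subset_S (k : ℕ) (c s : Bool) (R : ℤ) :
    (List.cons (c, s) '' S k (c, s) (R - 1)) ∪
      (List.cons (!c, true) '' S k (!c, true) (R - 1 - k)) ∪
      (List.cons (!c, false) '' S k (!c, false) (R - 1 - k)) ⊆ S k (c, s) R := by
  rintro L ((⟨L, ⟨h1, h2⟩, rfl⟩ | ⟨L, ⟨h1, h2⟩, rfl⟩) | ⟨L, ⟨h1, h2⟩, rfl⟩)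
  · refine ⟨?_, ?_⟩
    · unfold FreeGroup.IsReduced; rw [List.isChain_cons_cons]; exact ⟨fun _ => rfl, h1⟩
    · simp [wt] at h2 ⊢; omega
  · refine ⟨?_, ?_⟩
    · unfold FreeGroup.IsReduced; rw [List.isChain_cons_cons]; exact ⟨fun h => by simp at h, h1⟩
    · simp [wt] at h2 ⊢; omega
  · refine ⟨?_, ?_⟩
    · unfold FreeGroup.IsReduced; rw [List.isChain_cons_cons]; exact ⟨fun h => by simp at h, h1⟩
    · simp [wt] at h2 ⊢; omega

lemma S_card_le (k : ℕ) (c s : Bool) (R : ℤ) : (S k (c, s) R).ncard ≤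
    1 + (S k (c, s) (R - 1)).ncard + (S k (!c, true) (R - 1 - k)).ncard +
      (S k (!c, false) (R - 1 - k)).ncard := by
  refine (Set.ncard_le_ncard (S_subset k c s R) ?_).trans ?_
  · exact (((Set.finite_singleton _).union ((S_finite _ _ _).image _)).union
      ((S_finite _ _ _).image _)).union ((S_finite _ _ _).image _)
  · refine (Set.ncard_union_le _ _).trans (add_le_add ?_ (Set.ncard_image_le (S_finite _ _ _)))
    refine (Set.ncard_union_le _ _).trans (add_le_add ?_ (Set.ncard_image_le (S_finite _ _ _)))
    refine (Set.ncard_union_le _ _).trans (add_le_add ?_ (Set.ncard_image_le (S_finite _ _ _)))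
    simp

lemma le_S_card (k : ℕ) (c s : Bool) (R : ℤ) :
    (S k (c, s) (R - 1)).ncard + (S k (!c, true) (R - 1 - k)).ncard +
      (S k (!c, false) (R - 1 - k)).ncard ≤ (S k (c, s) R).ncard := by
  refine le_trans (le_of_eq ?_) (Set.ncard_le_ncard (subset_S k c s R) (S_finite _ _ _))
  have hf : ∀ l R, (List.cons l '' S k l R).Finite := fun l R => (S_finite _ _ _).image _
  rw [Set.ncard_union_eq _ ((hf _ _).union (hf _ _)) (hf _ _),
    Set.ncard_union_eq _ (hf _ _) (hf _ _)]
  · rw [Set.ncard_image_of_injective _ (List.cons_injective),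
      Set.ncard_image_of_injective _ (List.cons_injective),
      Set.ncard_image_of_injective _ (List.cons_injective)]
  · rw [Set.disjoint_left]
    rintro _ ⟨L, _, rfl⟩ ⟨L', _, h⟩
    simp at h
  · rw [Set.disjoint_left]
    rintro _ (⟨L, _, rfl⟩ | ⟨L, _, rfl⟩) ⟨L', _, h⟩ <;> simp at h

lemma S_upper (k : ℕ) (s C : ℝ) (hC : 0 < C) (hs : 0 ≤ s)
    (hq : 1 ≤ C * (1 - (Real.exp (-s) + 2 * Real.exp (-s * (k + 1))))) (n : ℕ) :
    ∀ (l : Bool × Bool) (R : ℤ), R < n → ((S k l R).ncard : ℝ) ≤ C * Real.exp (s * R) := by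
  have hneg : ∀ (l : Bool × Bool) (R : ℤ), R < 0 →
      ((S k l R).ncard : ℝ) ≤ C * Real.exp (s * R) := by
    intro l R hR
    have : S k l R = ∅ := by
      ext L; simp only [S, Set.mem_ofPred_eq, Set.mem_empty_iff_false, iff_false]; rintro ⟨_, h⟩; omega
    rw [this]; simp; positivity
  induction n with
  | zero => intro l R hR; exact hneg l R (by simpa using hR)
  | succ n ih =>
    rintro ⟨c, t⟩ R hR
    by_cases hR0 : R < 0
    · exact hneg _ R hR0
    push_cast at hR
    have h := S_card_le k c t R
    have h1 := ih (c, t) (R - 1) (by omega)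
    have h2 := ih (!c, true) (R - 1 - k) (by omega)
    have h3 := ih (!c, false) (R - 1 - k) (by omega)
    have e1 : Real.exp (s * ((R - 1 : ℤ) : ℝ)) = Real.exp (s * R) * Real.exp (-s) := by
      rw [← Real.exp_add]; congr 1; push_cast; ring
    have e2 : Real.exp (s * ((R - 1 - k : ℤ) : ℝ)) =
        Real.exp (s * R) * Real.exp (-s * (k + 1)) := by
      rw [← Real.exp_add]; congr 1; push_cast; ring
    rw [e1] at h1
    rw [e2] at h2 h3
    have h' : ((S k (c, t) R).ncard : ℝ) ≤ 1 + (S k (c, t) (R - 1)).ncard +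
      (S k (!c, true) (R - 1 - k)).ncard + (S k (!c, false) (R - 1 - k)).ncard := by
      exact_mod_cast h
    have hE : 1 ≤ Real.exp (s * R) := by
      apply Real.one_le_exp
      have : (0:ℝ) ≤ R := by exact_mod_cast not_lt.mp hR0
      positivity
    nlinarith [mul_le_mul hE hq zero_le_one (by positivity)]

lemma S_lower (k : ℕ) (s : ℝ) (hs : 0 ≤ s)
    (hq : 1 ≤ Real.exp (-s) + 2 * Real.exp (-s * (k + 1))) (n : ℕ) :
    ∀ (l : Bool × Bool) (R : ℤ), k ≤ R → R < n →
      Real.exp (s * (R - 2 * k)) ≤ ((S k l R).ncard : ℝ) := by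
  induction n with
  | zero => intro l R hR h; push_cast at h; omega
  | succ n ih =>
    rintro ⟨c, t⟩ R hk hR
    push_cast at hR
    by_cases hR0 : R ≤ 2 * k
    · have h1 : Real.exp (s * (R - 2 * k)) ≤ 1 := by
        rw [Real.exp_le_one_iff]
        have : (R:ℝ) ≤ 2 * k := by exact_mod_cast hR0
        nlinarith
      refine h1.trans ?_
      have : 0 < (S k (c, t) R).ncard := by
        rw [Set.ncard_pos (S_finite _ _ _)]
        refine ⟨[], by simp, ?_⟩
        simp only [wt]; split_ifs <;> push_cast <;> omega
      exact_mod_cast this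
    · have h := le_S_card k c t R
      have h1 := ih (c, t) (R - 1) (by omega) (by omega)
      have h2 := ih (!c, true) (R - 1 - k) (by omega) (by omega)
      have h3 := ih (!c, false) (R - 1 - k) (by omega) (by omega)
      have e1 : Real.exp (s * (((R - 1 : ℤ) : ℝ) - 2 * k)) =
          Real.exp (s * (R - 2 * k)) * Real.exp (-s) := by
        rw [← Real.exp_add]; congr 1; push_cast; ring
      have e2 : Real.exp (s * (((R - 1 - k : ℤ) : ℝ) - 2 * k)) =
          Real.exp (s * (R - 2 * k)) * Real.exp (-s * (k + 1)) := by
        rw [← Real.exp_add]; congr 1; push_cast; ring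
      rw [e1] at h1
      rw [e2] at h2 h3
      have h' : ((S k (c, t) (R - 1)).ncard : ℝ) +
        (S k (!c, true) (R - 1 - k)).ncard + (S k (!c, false) (R - 1 - k)).ncard ≤
          (S k (c, t) R).ncard := by
        exact_mod_cast h
      nlinarith [Real.exp_pos (s * (R - 2 * k))]

lemma T_upper (k : ℕ) (s : ℝ) (hs : 0 ≤ s)
    (hq : Real.exp (-s) + 2 * Real.exp (-s * (k + 1)) < 1) :
    ∃ C : ℝ, 0 < C ∧ ∀ R : ℕ, ((T k R).ncard : ℝ) ≤ C * Real.exp (s * R) := by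
  set q := Real.exp (-s) + 2 * Real.exp (-s * (k + 1))
  have hq' : 0 < 1 - q := by linarith
  set C := 1 / (1 - q) with hCdef
  have hC : 0 < C := by positivity
  have hCq : 1 ≤ C * (1 - q) := by rw [hCdef]; field_simp; rfl
  refine ⟨1 + 4 * C, by positivity, fun R => ?_⟩
  have hS : ∀ l, ((S k l R).ncard : ℝ) ≤ C * Real.exp (s * R) := fun l => by
    have := S_upper k s C hC hs hCq (R + 1) l R (by push_cast; omega)
    simpa using this
  have hsub : T k R ⊆ {[]} ∪ (List.cons (true, true) '' S k (true, true) R) ∪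
      (List.cons (true, false) '' S k (true, false) R) ∪
      (List.cons (false, true) '' S k (false, true) R) ∪
      (List.cons (false, false) '' S k (false, false) R) := by
    rintro L ⟨h1, h2⟩
    rcases L with _ | ⟨⟨c, t⟩, L⟩
    · simp
    · have h3 : L ∈ S k (c, t) R := ⟨h1, by simp only [wt] at h2 ⊢; omega⟩
      cases c <;> cases t <;> simp [h3]
  have hf : ∀ l, (List.cons l '' S k l R).Finite := fun l => (S_finite _ _ _).image _
  have hN : (T k R).ncard ≤ 1 + (S k (true, true) R).ncard + (S k (true, false) R).ncard +
      (S k (false, true) R).ncard + (S k (false, false) R).ncard := by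
    refine (Set.ncard_le_ncard hsub ?_).trans ?_
    · exact ((((Set.finite_singleton _).union (hf _)).union (hf _)).union (hf _)).union (hf _)
    · refine (Set.ncard_union_le _ _).trans (add_le_add ?_ (Set.ncard_image_le (S_finite _ _ _)))
      refine (Set.ncard_union_le _ _).trans (add_le_add ?_ (Set.ncard_image_le (S_finite _ _ _)))
      refine (Set.ncard_union_le _ _).trans (add_le_add ?_ (Set.ncard_image_le (S_finite _ _ _)))
      refine (Set.ncard_union_le _ _).trans (add_le_add ?_ (Set.ncard_image_le (S_finite _ _ _)))
      simp
  have hN' : ((T k R).ncard : ℝ) ≤ 1 + (S k (true, true) R).ncard + (S k (true, false) R).ncard +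
      (S k (false, true) R).ncard + (S k (false, false) R).ncard := by exact_mod_cast hN
  have hE : 1 ≤ Real.exp (s * R) := Real.one_le_exp (by positivity)
  linarith [hS (true, true), hS (true, false), hS (false, true), hS (false, false)]

lemma T_lower (k : ℕ) (s : ℝ) (hs : 0 ≤ s)
    (hq : 1 ≤ Real.exp (-s) + 2 * Real.exp (-s * (k + 1))) :
    ∃ c : ℝ, 0 < c ∧ ∀ R : ℕ, k + 1 ≤ R → c * Real.exp (s * R) ≤ ((T k R).ncard : ℝ) := by
  refine ⟨Real.exp (s * (-1 - 2 * k)), Real.exp_pos _, fun R hR => ?_⟩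
  have h := S_lower k s hs hq R (true, true) (R - 1) (by omega) (by omega)
  have hsub : List.cons (true, true) '' S k (true, true) (R - 1) ⊆ T k R := by
    rintro _ ⟨L, ⟨h1, h2⟩, rfl⟩
    refine ⟨h1, ?_⟩
    simp [wt] at h2 ⊢; omega
  have h2 := Set.ncard_le_ncard hsub (T_finite k R)
  rw [Set.ncard_image_of_injective _ List.cons_injective] at h2
  have h3 : ((S k (true, true) (R - 1)).ncard : ℝ) ≤ (T k R).ncard := by exact_mod_cast h2
  refine le_trans (le_of_eq ?_) (h.trans h3)
  rw [← Real.exp_add]; congr 1; push_cast; ring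

lemma analytic_lower (k : ℕ) (hk : 2 ≤ k) :
    1 ≤ Real.exp (-(1 / (k : ℝ))) + 2 * Real.exp (-(1 / (k : ℝ)) * (k + 1)) := by
  have hk0 : (0 : ℝ) < k := by positivity
  have hk2 : (2 : ℝ) ≤ k := by exact_mod_cast hk
  have e : Real.exp (-(1 / (k : ℝ)) * (k + 1)) =
      Real.exp (-(1 / (k : ℝ))) * Real.exp (-1) := by
    rw [← Real.exp_add]; congr 1; field_simp; ring
  have h1 : Real.exp (-(1/2)) ≤ Real.exp (-(1 / (k : ℝ))) := by
    apply Real.exp_le_exp.mpr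
    have := one_div_le_one_div_of_le (by norm_num : (0:ℝ) < 2) hk2
    linarith
  have h2 : 0.367 ≤ Real.exp (-1) := by
    have := Real.exp_neg_one_gt_d9; linarith
  have h3 : 0.6 ≤ Real.exp (-(1/2)) := by
    have : Real.exp (-(1/2)) ^ 2 = Real.exp (-1) := by
      rw [← Real.exp_nat_mul]; norm_num
    have := Real.exp_pos (-(1/2))
    nlinarith
  rw [e]
  nlinarith

lemma analytic_upper (k : ℕ) (hk : 2 ≤ k) :
    Real.exp (-(1 / Real.sqrt k)) + 2 * Real.exp (-(1 / Real.sqrt k) * (k + 1)) < 1 := by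
  have hk0 : (0 : ℝ) < k := by positivity
  set t := Real.sqrt k with ht
  have ht0 : 0 < t := Real.sqrt_pos.mpr hk0
  have htt : t * t = k := Real.mul_self_sqrt hk0.le
  have e : Real.exp (-(1 / t) * (k + 1)) = Real.exp (-(1 / t)) * Real.exp (-t) := by
    rw [← Real.exp_add, ← htt]; congr 1; field_simp; ring
  rw [e]
  have h1 : 1 + 1 / t ≤ Real.exp (1 / t) := by linarith [Real.add_one_le_exp (1 / t)]
  have h2 : 2 * t < Real.exp t := by
    have h := Real.add_one_le_exp (t - 1)
    have h' : Real.exp t = Real.exp (t - 1) * Real.exp 1 := by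
      rw [← Real.exp_add]; congr 1; ring
    have := Real.exp_one_gt_d9
    nlinarith
  have h3 : 2 * Real.exp (-t) < 1 / t := by
    rw [Real.exp_neg, lt_div_iff₀ ht0, mul_assoc, mul_comm, mul_assoc, inv_mul_lt_iff₀ (Real.exp_pos _)]
    linarith
  have h4 : Real.exp (-(1 / t)) * Real.exp (1 / t) = 1 := by
    rw [← Real.exp_add]; simp
  have h5 := Real.exp_pos (-(1 / t))
  nlinarith

lemma limsup_bounds (f : ℕ → ℕ) (s₁ s₂ c C : ℝ) (hc : 0 < c) (hC : 0 < C) (N : ℕ)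
    (h1 : ∀ R : ℕ, N ≤ R → c * Real.exp (s₁ * R) ≤ f R)
    (h2 : ∀ R : ℕ, (f R : ℝ) ≤ C * Real.exp (s₂ * R)) :
    s₁ ≤ atTop.limsup (fun R : ℕ => Real.log (f R : ℝ) / (R : ℝ)) ∧
    atTop.limsup (fun R : ℕ => Real.log (f R : ℝ) / (R : ℝ)) ≤ s₂ := by
  have ht : ∀ b s : ℝ, Tendsto (fun R : ℕ => b / (R : ℝ) + s) atTop (nhds s) := by
    intro b s
    simpa using (tendsto_const_div_atTop_nhds_zero_nat b).add_const s
  have hlo : (fun R : ℕ => Real.log c / (R : ℝ) + s₁) ≤ᶠ[atTop]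
      fun R : ℕ => Real.log (f R : ℝ) / (R : ℝ) := by
    filter_upwards [eventually_ge_atTop N, eventually_gt_atTop 0] with R hR hR0
    have hR' : (0 : ℝ) < R := by exact_mod_cast hR0
    have := Real.log_le_log (by positivity) (h1 R hR)
    rw [Real.log_mul hc.ne' (Real.exp_pos _).ne', Real.log_exp] at this
    rw [le_div_iff₀ hR', add_mul, div_mul_cancel₀ _ hR'.ne']
    exact this
  have hhi : (fun R : ℕ => Real.log (f R : ℝ) / (R : ℝ)) ≤ᶠ[atTop]
      fun R : ℕ => Real.log C / (R : ℝ) + s₂ := by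
    filter_upwards [eventually_ge_atTop N, eventually_gt_atTop 0] with R hR hR0
    have hR' : (0 : ℝ) < R := by exact_mod_cast hR0
    have := Real.log_le_log (lt_of_lt_of_le (by positivity) (h1 R hR)) (h2 R)
    rw [Real.log_mul hC.ne' (Real.exp_pos _).ne', Real.log_exp] at this
    rw [div_le_iff₀ hR', add_mul, div_mul_cancel₀ _ hR'.ne']
    exact this
  have hb := (ht (Real.log C) s₂).isBoundedUnder_le.mono_le hhi
  have hb' := (ht (Real.log c) s₁).isBoundedUnder_ge.mono_ge hlo
  constructor
  · rw [← (ht (Real.log c) s₁).limsup_eq]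
    exact limsup_le_limsup hlo (ht (Real.log c) s₁).isBoundedUnder_ge.isCoboundedUnder_le hb
  · rw [← (ht (Real.log C) s₂).limsup_eq]
    exact limsup_le_limsup hhi hb'.isCoboundedUnder_le (ht (Real.log C) s₂).isBoundedUnder_le

end ConjGen

theorem critExp_conj_generator_bounds (d : ℕ) (hd : 2 ≤ d)
    (g : FreeGroup (Fin d)) (hlen : 2 ≤ FreeGroup.norm g)
    (hhead : ∀ l ∈ (FreeGroup.toWord g).head?, (l.1 : ℕ) ≠ 0)
    (hlast : ∀ l ∈ (FreeGroup.toWord g).getLast?, (l.1 : ℕ) ≠ 0) :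
    ∀ a : FreeGroup (Fin d), a = FreeGroup.of (⟨0, by omega⟩ : Fin d) →
      1 / (FreeGroup.norm g : ℝ) ≤ critExp (Subgroup.closure {a, g * a * g⁻¹}) ∧
      critExp (Subgroup.closure {a, g * a * g⁻¹}) ≤
        1 / Real.sqrt (FreeGroup.norm g : ℝ) := by
  intro a ha
  subst ha
  have hG : ConjGen.Good (⟨0, by omega⟩ : Fin d) g.toWord := by
    refine ConjGen.good_toWord ?_ ?_ ?_
    · rintro rfl
      simp at hlen
    · intro l hl h
      exact hhead l hl (by rw [h])
    · intro l hl h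
      exact hlast l hl (by rw [h])
  obtain ⟨c, hc, h1⟩ := ConjGen.T_lower g.norm (1 / (g.norm : ℝ)) (by positivity)
    (ConjGen.analytic_lower _ hlen)
  obtain ⟨C, hC, h2⟩ := ConjGen.T_upper g.norm (1 / Real.sqrt (g.norm : ℝ)) (by positivity)
    (ConjGen.analytic_upper _ hlen)
  unfold critExp
  simp only [ConjGen.growthCount_eq hG]
  exact ConjGen.limsup_bounds _ _ _ c C hc hC _ h1 h2
end

section
/- Let d ≥ 2, let (Γ_k) be a sequence of subgroups of F_d, and let Γ be a subgroup of F_d such that (Γ_k) Chabauty-converges to Γ. Then liminf_{k → ∞} δ(Γ_k) ≥ δ(Γ). -/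
open Filter

section Words

variable {α : Type*} [DecidableEq α]

lemma cx_mk_inj {L M : List (α × Bool)} (hL : FreeGroup.IsReduced L) (hM : FreeGroup.IsReduced M)
    (h : FreeGroup.mk L = FreeGroup.mk M) : L = M := by
  have := FreeGroup.reduce.sound h
  rwa [hL.reduce_eq, hM.reduce_eq] at this

lemma cx_invRev {L : List (α × Bool)} (hL : FreeGroup.IsReduced L) :
    FreeGroup.IsReduced (FreeGroup.invRev L) := by
  rw [FreeGroup.isReduced_iff_reduce_eq, FreeGroup.reduce_invRev, hL.reduce_eq]

/-- Left multiplication by a short word only changes a prefix. -/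
lemma cx_left (h p : List (α × Bool)) (hlen : h.length < p.length) :
    ∃ p' : List (α × Bool), p.length ≤ p'.length + h.length ∧ p'.length ≤ p.length + h.length ∧
      ∀ w, FreeGroup.IsReduced (p ++ w) → FreeGroup.IsReduced (p' ++ w) ∧
        FreeGroup.mk h * FreeGroup.mk (p ++ w) = FreeGroup.mk (p' ++ w) := by
  induction h with
  | nil =>
    refine ⟨p, by simp, by simp, fun w hw => ⟨hw, ?_⟩⟩
    rw [FreeGroup.mul_mk]; rfl
  | cons x h ih =>
    simp only [List.length_cons] at hlen ⊢
    obtain ⟨q, h1, h2, h3⟩ := ih (by omega)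
    have key : ∀ L, FreeGroup.mk (x :: h) * FreeGroup.mk L
        = FreeGroup.mk [x] * (FreeGroup.mk h * FreeGroup.mk L) := by
      intro L
      simp [FreeGroup.mul_mk]
    cases q with
    | nil => simp at h1; omega
    | cons y q =>
      simp only [List.length_cons] at h1 h2
      by_cases hxy : x.1 = y.1 → x.2 = y.2
      · refine ⟨x :: y :: q, by simp; omega, by simp; omega, fun w hw => ?_⟩
        obtain ⟨h4, h5⟩ := h3 w hw
        refine ⟨?_, ?_⟩
        · simp only [List.cons_append] at h4 ⊢
          rw [FreeGroup.IsReduced, List.isChain_cons_cons]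
          exact ⟨hxy, h4⟩
        · rw [key, h5, FreeGroup.mul_mk]; rfl
      · refine ⟨q, by omega, by omega, fun w hw => ?_⟩
        obtain ⟨h4, h5⟩ := h3 w hw
        refine ⟨h4.infix ⟨[y], [], by simp⟩, ?_⟩
        rw [key, h5, FreeGroup.mul_mk]
        push Not at hxy
        obtain ⟨x1, x2⟩ := x
        obtain ⟨y1, y2⟩ := y
        obtain ⟨rfl, hb⟩ := hxy
        have : y2 = !x2 := by cases x2 <;> cases y2 <;> simp_all
        subst this
        exact Quot.sound (by simp)

lemma cx_split {β : Type*} (P Q : List β) (hl : P.length = Q.length) (hne : P ≠ Q) :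
    ∃ u x y P' Q', P = u ++ x :: P' ∧ Q = u ++ y :: Q' ∧ x ≠ y := by
  induction P generalizing Q with
  | nil => cases Q <;> simp_all
  | cons a P ih =>
    cases Q with
    | nil => simp at hl
    | cons b Q =>
      by_cases hab : a = b
      · subst hab
        obtain ⟨u, x, y, P', Q', h1, h2, h3⟩ := ih Q (by simpa using hl) (by simpa using hne)
        exact ⟨a :: u, x, y, P', Q', by simp [h1], by simp [h2], h3⟩
      · exact ⟨[], a, b, P, Q, rfl, rfl, hab⟩

end Words

section Growth

variable {d : ℕ}

lemma cx_ball_inj (R : ℕ) : Function.Injective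
    (fun g : {g : FreeGroup (Fin d) // FreeGroup.norm g ≤ R} =>
      fun i : Fin R => g.1.toWord[(i : ℕ)]?) := by
  intro g h hgh
  apply Subtype.ext
  apply FreeGroup.toWord_injective
  apply List.ext_getElem?
  intro i
  by_cases hi : i < R
  · exact congrFun hgh ⟨i, hi⟩
  · have h1 : g.1.toWord.length ≤ R := g.2
    have h2 : h.1.toWord.length ≤ R := h.2
    rw [List.getElem?_eq_none (by omega), List.getElem?_eq_none (by omega)]

lemma cx_ball_finite (R : ℕ) : {g : FreeGroup (Fin d) | FreeGroup.norm g ≤ R}.Finite := by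
  exact Set.finite_coe_iff.1 (Finite.of_injective _ (cx_ball_inj (d := d) R))

lemma cx_gball_finite (Γ : Subgroup (FreeGroup (Fin d))) (R : ℕ) :
    {g : FreeGroup (Fin d) | g ∈ Γ ∧ FreeGroup.norm g ≤ R}.Finite :=
  (cx_ball_finite R).subset fun _ h => h.2

instance cx_inst (Γ : Subgroup (FreeGroup (Fin d))) (R : ℕ) :
    Finite {g : FreeGroup (Fin d) // g ∈ Γ ∧ FreeGroup.norm g ≤ R} :=
  (cx_gball_finite Γ R).to_subtype

lemma cx_count_pos (Γ : Subgroup (FreeGroup (Fin d))) (R : ℕ) : 1 ≤ growthCount Γ R := by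
  have : Nonempty {g : FreeGroup (Fin d) // g ∈ Γ ∧ FreeGroup.norm g ≤ R} :=
    ⟨⟨1, Γ.one_mem, by simp⟩⟩
  exact Nat.card_pos

lemma cx_count_le (Γ : Subgroup (FreeGroup (Fin d))) (R : ℕ) :
    growthCount Γ R ≤ (2 * d + 1) ^ R := by
  have h := Nat.card_le_card_of_injective
    (fun g : {g : FreeGroup (Fin d) // g ∈ Γ ∧ FreeGroup.norm g ≤ R} =>
      fun i : Fin R => g.1.toWord[(i : ℕ)]?) (by
      intro g h hgh
      have := @cx_ball_inj d R ⟨g.1, g.2.2⟩ ⟨h.1, h.2.2⟩ hgh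
      exact Subtype.ext (Subtype.mk.inj this))
  refine h.trans (le_of_eq ?_)
  simp [Nat.card_eq_fintype_card, mul_comm]

lemma cx_ratio_nonneg (Γ : Subgroup (FreeGroup (Fin d))) (R : ℕ) :
    0 ≤ Real.log (growthCount Γ R : ℝ) / (R : ℝ) :=
  div_nonneg (Real.log_nonneg (by exact_mod_cast cx_count_pos Γ R)) (by positivity)

lemma cx_ratio_le (Γ : Subgroup (FreeGroup (Fin d))) (R : ℕ) :
    Real.log (growthCount Γ R : ℝ) / (R : ℝ) ≤ Real.log (2 * d + 1) := by
  have h0 : (0:ℝ) ≤ Real.log (2 * d + 1) := Real.log_nonneg (by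
    have : (0:ℝ) ≤ d := by positivity
    linarith)
  rcases Nat.eq_zero_or_pos R with rfl | hR
  · simpa using h0
  · rw [div_le_iff₀ (by exact_mod_cast hR), mul_comm, ← Real.log_pow]
    apply Real.log_le_log
    · exact_mod_cast cx_count_pos Γ R
    · exact_mod_cast cx_count_le Γ R

lemma cx_bdd (Γ : Subgroup (FreeGroup (Fin d))) :
    atTop.IsBoundedUnder (· ≤ ·) fun R : ℕ => Real.log (growthCount Γ R : ℝ) / (R : ℝ) :=
  isBoundedUnder_of ⟨_, cx_ratio_le Γ⟩

lemma cx_cobdd (Γ : Subgroup (FreeGroup (Fin d))) :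
    atTop.IsCoboundedUnder (· ≤ ·) fun R : ℕ => Real.log (growthCount Γ R : ℝ) / (R : ℝ) :=
  (isBoundedUnder_of ⟨0, cx_ratio_nonneg Γ⟩ :
    atTop.IsBoundedUnder (· ≥ ·) _).isCoboundedUnder_le

lemma cx_crit_nonneg (Γ : Subgroup (FreeGroup (Fin d))) : 0 ≤ critExp Γ :=
  le_limsup_of_frequently_le (Frequently.of_forall (cx_ratio_nonneg Γ)) (cx_bdd Γ)

lemma cx_crit_le (Γ : Subgroup (FreeGroup (Fin d))) : critExp Γ ≤ Real.log (2 * d + 1) :=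
  limsup_le_of_le (cx_cobdd Γ) (Eventually.of_forall (cx_ratio_le Γ))

/-- Free semigroups in `Δ`, up to conjugation. -/
lemma cx_semigroup (Δ : Subgroup (FreeGroup (Fin d))) (u : FreeGroup (Fin d))
    (S : Finset (List (Fin d × Bool))) (n : ℕ) (x z : Fin d × Bool)
    (hxz : z.1 = x.1 → z.2 = x.2)
    (hS : ∀ s ∈ S, s.length = n ∧ FreeGroup.IsReduced s ∧ s.head? = some x ∧
      s.getLast? = some z ∧ u * FreeGroup.mk s * u⁻¹ ∈ Δ) (k : ℕ) :
    S.card ^ k ≤ growthCount Δ (k * n + 2 * FreeGroup.norm u) := by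
  have hred : ∀ f : Fin k → S,
      FreeGroup.IsReduced (List.ofFn fun i => (f i : List (Fin d × Bool))).flatten := by
    intro f
    rw [FreeGroup.IsReduced, List.isChain_flatten]
    · refine ⟨?_, ?_⟩
      · intro l hl
        obtain ⟨i, rfl⟩ := (List.mem_ofFn' _ _).1 hl
        exact (hS _ (f i).2).2.1
      · rw [List.isChain_iff_getElem]
        intro i hi a ha b hb
        simp only [List.getElem_ofFn] at ha hb
        rw [(hS _ (f _).2).2.2.2.1] at ha
        rw [(hS _ (f _).2).2.2.1] at hb
        simp at ha hb
        subst ha hb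
        exact hxz
    · intro hmem
      obtain ⟨i, hi⟩ := (List.mem_ofFn' _ _).1 hmem
      have := (hS _ (f i).2).2.2.1
      simp only at hi
      rw [hi] at this
      simp at this
  have hmem : ∀ l : List (List (Fin d × Bool)), (∀ s ∈ l, s ∈ S) →
      u * FreeGroup.mk l.flatten * u⁻¹ ∈ Δ := by
    intro l
    induction l with
    | nil => intro _; simp [← FreeGroup.one_eq_mk]
    | cons s l ih =>
      intro h
      have h1 := (hS s (h s (by simp))).2.2.2.2
      have h2 := ih fun t ht => h t (by simp [ht])
      have := Δ.mul_mem h1 h2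
      rw [List.flatten_cons, ← FreeGroup.mul_mk]
      convert this using 1
      group
  have hlen : ∀ l : List (List (Fin d × Bool)), (∀ s ∈ l, s ∈ S) →
      l.flatten.length = l.length * n := by
    intro l
    induction l with
    | nil => simp
    | cons s l ih =>
      intro h
      have h1 := (hS s (h s (by simp))).1
      have h2 := ih fun t ht => h t (by simp [ht])
      simp only [List.flatten_cons, List.length_append, List.length_cons, h1, h2]
      ring
  have hin : ∀ f : Fin k → S, ∀ s ∈ (List.ofFn fun i => (f i : List (Fin d × Bool))), s ∈ S := by
    intro f s hs
    obtain ⟨i, rfl⟩ := (List.mem_ofFn' _ _).1 hs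
    exact (f i).2
  let F : (Fin k → S) → {g : FreeGroup (Fin d) // g ∈ Δ ∧
      FreeGroup.norm g ≤ k * n + 2 * FreeGroup.norm u} := fun f =>
    ⟨u * FreeGroup.mk (List.ofFn fun i => (f i : List (Fin d × Bool))).flatten * u⁻¹,
      hmem _ (hin f), by
        have h1 := FreeGroup.norm_mul_le
          (u * FreeGroup.mk (List.ofFn fun i => (f i : List (Fin d × Bool))).flatten) u⁻¹
        have h2 := FreeGroup.norm_mul_le
          u (FreeGroup.mk (List.ofFn fun i => (f i : List (Fin d × Bool))).flatten)
        have h3 := FreeGroup.norm_mk_le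
          (L₁ := (List.ofFn fun i => (f i : List (Fin d × Bool))).flatten)
        rw [hlen _ (hin f), List.length_ofFn] at h3
        rw [FreeGroup.norm_inv_eq] at h1
        omega⟩
  have hF : Function.Injective F := by
    intro f g hfg
    have h1 := congrArg Subtype.val hfg
    simp only [F, mul_left_inj, mul_right_inj] at h1
    have h2 := cx_mk_inj (hred f) (hred g) h1
    have h3 : (List.ofFn fun i => (f i : List (Fin d × Bool))) =
        List.ofFn fun i => (g i : List (Fin d × Bool)) := by
      rw [List.eq_iff_flatten_eq]
      refine ⟨h2, ?_⟩
      simp only [List.map_ofFn]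
      congr 1
      funext i
      simp [(hS _ (f i).2).1, (hS _ (g i).2).1]
    have h4 := List.ofFn_injective h3
    funext i
    exact Subtype.ext (congrFun h4 i)
  have := Nat.card_le_card_of_injective F hF
  simpa [growthCount, Nat.card_eq_fintype_card] using this

lemma cx_crit_ge (Δ : Subgroup (FreeGroup (Fin d))) (N n t : ℕ) (hn : 1 ≤ n) (c : ℝ)
    (hN : Real.exp (c * n) ≤ N)
    (h : ∀ k : ℕ, N ^ k ≤ growthCount Δ (k * n + t)) : c ≤ critExp Δ := by
  apply le_of_forall_lt
  intro c' hc'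
  obtain ⟨c'', h1, h2⟩ := exists_between hc'
  refine h1.trans_le ?_
  apply le_limsup_of_frequently_le _ (cx_bdd Δ)
  have htend : Tendsto (fun k : ℕ => k * n + t) atTop atTop := by
    apply tendsto_atTop_mono (f := fun k => k) _ tendsto_id
    intro k
    nlinarith
  apply htend.frequently
  apply Eventually.frequently
  have h3 : ∀ᶠ k : ℕ in atTop, c'' * t / (c - c'') ≤ (k : ℝ) :=
    tendsto_natCast_atTop_atTop.eventually_ge_atTop _
  filter_upwards [h3, eventually_ge_atTop 1] with k hk hk1
  have hn' : (1:ℝ) ≤ n := by exact_mod_cast hn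
  have hk1' : (1:ℝ) ≤ k := by exact_mod_cast hk1
  rw [div_le_iff₀ (by linarith)] at hk
  push_cast
  rw [le_div_iff₀ (by positivity)]
  have h4 : (k:ℝ) * (c * n) ≤ Real.log (growthCount Δ (k * n + t) : ℝ) := by
    rw [Real.le_log_iff_exp_le (by exact_mod_cast cx_count_pos Δ _), Real.exp_nat_mul]
    calc Real.exp (c * n) ^ k ≤ (N:ℝ) ^ k := by gcongr
      _ ≤ _ := by exact_mod_cast h k
  refine le_trans ?_ h4
  have : (k:ℝ) * (c - c'') ≤ k * (c - c'') * n :=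
    le_mul_of_one_le_right (mul_nonneg (by linarith) (by linarith)) hn'
  nlinarith

/-- `h` maps the cylinder of `p` to the cylinder of `P`. -/
def CxMoves (h : FreeGroup (Fin d)) (p P : List (Fin d × Bool)) : Prop :=
  ∀ w, FreeGroup.IsReduced (p ++ w) → FreeGroup.IsReduced (P ++ w) ∧
    h * FreeGroup.mk (p ++ w) = FreeGroup.mk (P ++ w)

lemma cx_pigeon (Γ : Subgroup (FreeGroup (Fin d))) (m : ℕ) (hm : 2 * m + 1 < growthCount Γ m)
    (p : List (Fin d × Bool)) (hp : FreeGroup.IsReduced p) (hpl : p.length = m + 1) :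
    ∃ h₁ ∈ Γ, ∃ h₂ ∈ Γ, ∃ P Q, P.length = Q.length ∧ P.length ≤ 2 * m + 1 ∧ P ≠ Q ∧
      CxMoves h₁ p P ∧ CxMoves h₂ p Q := by
  have hex : ∀ g : {g : FreeGroup (Fin d) // g ∈ Γ ∧ FreeGroup.norm g ≤ m},
      ∃ P : List (Fin d × Bool), 1 ≤ P.length ∧ P.length ≤ 2 * m + 1 ∧ CxMoves g.1 p P := by
    intro g
    have hg : g.1.toWord.length ≤ m := g.2.2
    obtain ⟨P, h1, h2, h3⟩ := cx_left g.1.toWord p (by omega)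
    rw [FreeGroup.mk_toWord] at h3
    exact ⟨P, by omega, by omega, h3⟩
  choose P hP1 hP2 hP3 using hex
  have hnot : ¬ Function.Injective (fun g => (⟨(P g).length - 1, by
      have := hP1 g; have := hP2 g; omega⟩ : Fin (2 * m + 1))) := by
    intro hinj
    have := Nat.card_le_card_of_injective _ hinj
    rw [Nat.card_eq_fintype_card (α := Fin (2 * m + 1)), Fintype.card_fin] at this
    unfold growthCount at hm
    omega
  simp only [Function.Injective, not_forall] at hnot
  obtain ⟨g, h, hgh, hne⟩ := hnot
  simp only [Fin.mk.injEq] at hgh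
  refine ⟨g.1, g.2.1, h.1, h.2.1, P g, P h, ?_, hP2 g, ?_, hP3 g, hP3 h⟩
  · have := hP1 g; have := hP1 h; omega
  · intro heq
    have h1 := (hP3 g [] (by simpa using hp)).2
    have h2 := (hP3 h [] (by simpa using hp)).2
    rw [heq, ← h2] at h1
    exact hne (Subtype.ext (mul_right_cancel h1))

lemma cx_pair (Γ : Subgroup (FreeGroup (Fin d))) (m : ℕ) (hm : 2 * m + 1 < growthCount Γ m)
    (p q : List (Fin d × Bool)) (hp : FreeGroup.IsReduced p)
    (hpl : p.length = m + 1) (hql : q.length = m + 1) :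
    ∃ h₁ ∈ Γ, ∃ h₂ ∈ Γ, ∃ P Q, P.length = Q.length ∧ P.length ≤ 2 * m + 1 ∧ P ≠ Q ∧
      CxMoves h₁ p P ∧ CxMoves h₂ q Q := by
  by_cases hpq : p = q
  · subst hpq
    exact cx_pigeon Γ m hm p hp hpl
  · exact ⟨1, Γ.one_mem, 1, Γ.one_mem, p, q, by omega, by omega, hpq,
      fun w hw => ⟨hw, one_mul _⟩, fun w hw => ⟨hw, one_mul _⟩⟩

lemma cx_moves_both {h₁ h₂ : FreeGroup (Fin d)} {p q P Q : List (Fin d × Bool)}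
    (h1 : CxMoves h₁ p P) (h2 : CxMoves h₂ q Q) (w : List (Fin d × Bool))
    (hw : FreeGroup.IsReduced (p ++ w ++ FreeGroup.invRev q)) :
    FreeGroup.IsReduced (P ++ w ++ FreeGroup.invRev Q) ∧
      h₁ * FreeGroup.mk (p ++ w ++ FreeGroup.invRev q) * h₂⁻¹
        = FreeGroup.mk (P ++ w ++ FreeGroup.invRev Q) := by
  rw [List.append_assoc] at hw
  obtain ⟨a1, a2⟩ := h1 _ hw
  have a3 := cx_invRev a1
  simp only [FreeGroup.invRev_append, FreeGroup.invRev_invRev, List.append_assoc] at a3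
  obtain ⟨b1, b2⟩ := h2 _ a3
  have b3 := cx_invRev b1
  simp only [FreeGroup.invRev_append, FreeGroup.invRev_invRev, List.append_assoc] at b3
  refine ⟨by simpa using b3, ?_⟩
  have b4 := congrArg (·⁻¹) b2
  simp only [mul_inv_rev, FreeGroup.inv_mk, FreeGroup.invRev_append, FreeGroup.invRev_invRev,
    List.append_assoc] at b4
  simp only [List.append_assoc]
  rw [a2, ← b4]

lemma cx_fin (Γ : Subgroup (FreeGroup (Fin d))) (m : ℕ) (hm : 2 * m + 1 < growthCount Γ m)
    (p q : List (Fin d × Bool)) (hpl : p.length = m + 1) (hql : q.length = m + 1)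
    (j : ℕ) (T : Finset (List (Fin d × Bool))) (c : ℝ) (hc : 0 ≤ c)
    (hT : ∀ w ∈ T, w.length = j ∧ FreeGroup.IsReduced (p ++ w ++ FreeGroup.invRev q) ∧
      FreeGroup.mk (p ++ w ++ FreeGroup.invRev q) ∈ Γ)
    (hcard : Real.exp (c * (j + 4 * m + 2)) ≤ T.card) :
    ∃ F : Finset (FreeGroup (Fin d)), (∀ g ∈ F, g ∈ Γ) ∧
      ∀ Δ : Subgroup (FreeGroup (Fin d)), (∀ g ∈ F, g ∈ Δ) → c ≤ critExp Δ := by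
  classical
  have hTne : T.Nonempty := by
    rw [← Finset.card_pos]
    exact_mod_cast (Real.exp_pos _).trans_le hcard
  obtain ⟨w0, hw0⟩ := hTne
  have hp : FreeGroup.IsReduced p := (hT w0 hw0).2.1.infix ⟨[], w0 ++ FreeGroup.invRev q, by simp⟩
  obtain ⟨h₁, hh₁, h₂, hh₂, P, Q, hPQ, hPl, hne, m1, m2⟩ := cx_pair Γ m hm p q hp hpl hql
  obtain ⟨u, x, y, P', Q', rfl, rfl, hxy⟩ := cx_split P Q hPQ hne
  have hboth := fun w hw => cx_moves_both m1 m2 w (hT w hw).2.1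
  refine ⟨T.image fun w => FreeGroup.mk (u ++ x :: P' ++ w ++ FreeGroup.invRev (u ++ y :: Q')),
    ?_, ?_⟩
  · intro g hg
    obtain ⟨w, hw, rfl⟩ := Finset.mem_image.1 hg
    rw [← (hboth w hw).2]
    exact Γ.mul_mem (Γ.mul_mem hh₁ (hT w hw).2.2) (Γ.inv_mem hh₂)
  · intro Δ hΔ
    let f : List (Fin d × Bool) → List (Fin d × Bool) := fun w =>
      x :: P' ++ w ++ (FreeGroup.invRev Q' ++ [(y.1, !y.2)])
    have hf : ∀ w, u ++ x :: P' ++ w ++ FreeGroup.invRev (u ++ y :: Q')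
        = u ++ f w ++ FreeGroup.invRev u := by
      intro w
      simp [f, FreeGroup.invRev]
    have hfinj : Function.Injective f := by
      intro a b hab
      simpa [f] using hab
    have hlP : P'.length = Q'.length := by simpa using hPQ
    apply cx_crit_ge Δ (T.image f).card (P'.length + 1 + j + (Q'.length + 1))
      (2 * FreeGroup.norm (FreeGroup.mk u)) (by omega) c
    · rw [Finset.card_image_of_injective _ hfinj]
      refine le_trans (Real.exp_le_exp.2 (mul_le_mul_of_nonneg_left ?_ hc)) hcard
      simp only [List.length_append, List.length_cons] at hPl
      have : P'.length + 1 + j + (Q'.length + 1) ≤ j + 4 * m + 2 := by omega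
      exact_mod_cast this
    · apply cx_semigroup Δ (FreeGroup.mk u) (T.image f) _ x (y.1, !y.2)
      · intro h
        simp only at h ⊢
        obtain ⟨x1, x2⟩ := x
        obtain ⟨y1, y2⟩ := y
        cases x2 <;> cases y2 <;> simp_all
      · intro s hs
        obtain ⟨w, hw, rfl⟩ := Finset.mem_image.1 hs
        obtain ⟨r1, r2⟩ := hboth w hw
        refine ⟨?_, ?_, ?_, ?_, ?_⟩
        · simp [f, (hT w hw).1]; omega
        · rw [hf] at r1
          exact r1.infix ⟨u, FreeGroup.invRev u, rfl⟩
        · simp [f]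
        · simp only [f, ← List.append_assoc]
          rw [List.getLast?_concat]
        · have := hΔ _ (Finset.mem_image_of_mem _ hw)
          rw [hf] at this
          rwa [FreeGroup.inv_mk, FreeGroup.mul_mk, FreeGroup.mul_mk]

/-- The words of length `ℓ`. -/
noncomputable def cxWords (d ℓ : ℕ) : Finset (List (Fin d × Bool)) :=
  (List.finite_length_eq (Fin d × Bool) ℓ).toFinset

lemma cx_mem_words {ℓ : ℕ} {l : List (Fin d × Bool)} : l ∈ cxWords d ℓ ↔ l.length = ℓ := by
  simp [cxWords]

open Classical in
/-- The middle parts of the elements of `Γ` with prefix `p` and suffix `q⁻¹`. -/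
noncomputable def cxMid (Γ : Subgroup (FreeGroup (Fin d))) (j : ℕ) (p q : List (Fin d × Bool)) :
    Finset (List (Fin d × Bool)) :=
  (cxWords d j).filter fun w => FreeGroup.IsReduced (p ++ w ++ FreeGroup.invRev q) ∧
      FreeGroup.mk (p ++ w ++ FreeGroup.invRev q) ∈ Γ

lemma cx_count_bound (Γ : Subgroup (FreeGroup (Fin d))) (ℓ R : ℕ) (E : ℝ)
    (hE : ∀ j ≤ R, ∀ p ∈ cxWords d ℓ, ∀ q ∈ cxWords d ℓ, ((cxMid Γ j p q).card : ℝ) ≤ E) :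
    (growthCount Γ R : ℝ) ≤ growthCount Γ (2 * ℓ) + (R + 1) * ((cxWords d ℓ).card ^ 2) * E := by
  classical
  have hgc : ∀ R, growthCount Γ R = (cx_gball_finite Γ R).toFinset.card := by
    intro R
    rw [growthCount, ← Set.ncard_eq_toFinset_card _ (cx_gball_finite Γ R)]
    rfl
  let I := Finset.range (R + 1) ×ˢ (cxWords d ℓ ×ˢ cxWords d ℓ)
  let G : ℕ × List (Fin d × Bool) × List (Fin d × Bool) → Finset (FreeGroup (Fin d)) := fun i =>
    (cxMid Γ i.1 i.2.1 i.2.2).image fun w => FreeGroup.mk (i.2.1 ++ w ++ FreeGroup.invRev i.2.2)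
  have hsub : (cx_gball_finite Γ R).toFinset ⊆
      (cx_gball_finite Γ (2 * ℓ)).toFinset ∪ I.biUnion G := by
    intro g hg
    simp only [Set.Finite.mem_toFinset, Set.mem_ofPred_eq] at hg
    rw [Finset.mem_union]
    by_cases hn : FreeGroup.norm g ≤ 2 * ℓ
    · left; simp [hg.1, hn]
    · right
      rw [Finset.mem_biUnion]
      have hlen : g.toWord.length = FreeGroup.norm g := rfl
      have hR := hg.2
      set L := g.toWord with hL
      have hdec : L.take ℓ ++ (L.drop ℓ).take (L.length - 2 * ℓ) ++
          FreeGroup.invRev (FreeGroup.invRev ((L.drop ℓ).drop (L.length - 2 * ℓ))) = L := by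
        rw [FreeGroup.invRev_invRev, List.append_assoc, List.take_append_drop,
          List.take_append_drop]
      refine ⟨(L.length - 2 * ℓ, L.take ℓ,
        FreeGroup.invRev ((L.drop ℓ).drop (L.length - 2 * ℓ))), ?_, ?_⟩
      · simp only [I, Finset.mem_product, Finset.mem_range, cx_mem_words,
          FreeGroup.invRev_length, List.length_take, List.length_drop]
        omega
      · simp only [G, Finset.mem_image]
        refine ⟨(L.drop ℓ).take (L.length - 2 * ℓ), ?_, ?_⟩
        · simp only [cxMid, Finset.mem_filter, cx_mem_words]
          rw [hdec]
          refine ⟨?_, FreeGroup.isReduced_toWord, ?_⟩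
          · simp only [List.length_take, List.length_drop]; omega
          · rw [hL, FreeGroup.mk_toWord]; exact hg.1
        · rw [hdec, hL, FreeGroup.mk_toWord]
  have h1 := (Finset.card_le_card hsub).trans (Finset.card_union_le _ _)
  have h2 : ((I.biUnion G).card : ℝ) ≤ I.card * E := by
    calc ((I.biUnion G).card : ℝ) ≤ ((∑ i ∈ I, (G i).card : ℕ) : ℝ) := by
          exact_mod_cast Finset.card_biUnion_le
      _ = ∑ i ∈ I, ((G i).card : ℝ) := by push_cast; rfl
      _ ≤ ∑ i ∈ I, E := by
          apply Finset.sum_le_sum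
          intro i hi
          simp only [I, Finset.mem_product, Finset.mem_range] at hi
          refine le_trans ?_ (hE i.1 (by omega) i.2.1 hi.2.1 i.2.2 hi.2.2)
          exact_mod_cast Finset.card_image_le
      _ = I.card * E := by simp
  have hI : (I.card : ℝ) = (R + 1) * ((cxWords d ℓ).card ^ 2) := by
    simp only [I, Finset.card_product, Finset.card_range]
    push_cast
    ring
  rw [hI] at h2
  rw [hgc, hgc]
  have h1' : ((cx_gball_finite Γ R).toFinset.card : ℝ) ≤
      (cx_gball_finite Γ (2 * ℓ)).toFinset.card + (I.biUnion G).card := by exact_mod_cast h1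
  linarith

lemma cx_exp (b : ℝ) (hb : 0 < b) (A B : ℝ) :
    ∀ᶠ R : ℕ in atTop, A + B * R < Real.exp (b * R) := by
  have h1 : (fun x : ℝ => A + B * x) =o[atTop] fun x => Real.exp (b * x) := by
    have e0 := isLittleO_pow_exp_pos_mul_atTop 0 hb
    have e1 := isLittleO_pow_exp_pos_mul_atTop 1 hb
    simpa using (e0.const_mul_left A).add (e1.const_mul_left B)
  have h2 := tendsto_natCast_atTop_atTop (R := ℝ) |>.eventually
    (h1.def (show (0:ℝ) < 1 / 2 by norm_num))
  filter_upwards [h2] with R hR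
  rw [Real.norm_eq_abs, Real.norm_eq_abs, abs_of_pos (Real.exp_pos _)] at hR
  have := le_abs_self (A + B * (R:ℝ))
  have := Real.exp_pos (b * R)
  linarith

lemma cx_freq (Γ : Subgroup (FreeGroup (Fin d))) (c : ℝ) (h : c < critExp Γ) :
    ∃ᶠ R : ℕ in atTop, Real.exp (c * R) < growthCount Γ R := by
  have h1 := (frequently_lt_of_lt_limsup (cx_cobdd Γ) h).and_eventually (eventually_ge_atTop 1)
  refine h1.mono ?_
  rintro R ⟨hR, hR1⟩
  rw [lt_div_iff₀ (by exact_mod_cast hR1)] at hR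
  rwa [Real.lt_log_iff_exp_lt (by exact_mod_cast cx_count_pos Γ R)] at hR

/-- The critical exponent is approximated by finitely many elements. -/
lemma cx_key (Γ : Subgroup (FreeGroup (Fin d))) (c : ℝ) (hc : 0 ≤ c) (h : c < critExp Γ) :
    ∃ F : Finset (FreeGroup (Fin d)), (∀ g ∈ F, g ∈ Γ) ∧
      ∀ Δ : Subgroup (FreeGroup (Fin d)), (∀ g ∈ F, g ∈ Δ) → c ≤ critExp Δ := by
  obtain ⟨c', hcc', hc'⟩ := exists_between h
  obtain ⟨m, hm1, hm2⟩ := ((cx_freq Γ c' hc').and_eventually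
    (cx_exp c' (by linarith) 1 2)).exists
  have hm : 2 * m + 1 < growthCount Γ m := by
    have : (1 + 2 * m : ℝ) < growthCount Γ m := hm2.trans hm1
    have : 1 + 2 * m < growthCount Γ m := by exact_mod_cast this
    omega
  set K : ℝ := ((cxWords d (m + 1)).card : ℝ) ^ 2 * Real.exp (c * (4 * m + 2)) with hK
  set C : ℝ := (growthCount Γ (2 * (m + 1)) : ℝ) with hC
  obtain ⟨R, hR1, hR2⟩ := ((cx_freq Γ c' hc').and_eventually
    (cx_exp (c' - c) (by linarith) (C + K) K)).exists
  by_contra hcon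
  have hE : ∀ j ≤ R, ∀ p ∈ cxWords d (m + 1), ∀ q ∈ cxWords d (m + 1),
      ((cxMid Γ j p q).card : ℝ) ≤ Real.exp (c * (R + 4 * m + 2)) := by
    intro j hj p hp q hq
    by_contra hlt
    push Not at hlt
    apply hcon
    refine cx_fin Γ m hm p q (cx_mem_words.1 hp) (cx_mem_words.1 hq) j (cxMid Γ j p q) c hc ?_ ?_
    · intro w hw
      simpa [cxMid, cx_mem_words] using hw
    · refine le_trans (Real.exp_le_exp.2 (mul_le_mul_of_nonneg_left ?_ hc)) hlt.le
      have : (j:ℝ) ≤ R := by exact_mod_cast hj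
      linarith
  have hb := cx_count_bound Γ (m + 1) R _ hE
  rw [← hC] at hb
  have e1 : Real.exp (c * (R + 4 * m + 2)) = Real.exp (c * R) * Real.exp (c * (4 * m + 2)) := by
    rw [← Real.exp_add]; congr 1; ring
  have e2 : Real.exp (c' * R) = Real.exp (c * R) * Real.exp ((c' - c) * R) := by
    rw [← Real.exp_add]; congr 1; ring
  have e3 : 1 ≤ Real.exp (c * R) := Real.one_le_exp (by positivity)
  have hC0 : 0 ≤ C := by positivity
  have e4 : (R + 1) * ((cxWords d (m + 1)).card : ℝ) ^ 2 * Real.exp (c * (R + 4 * m + 2))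
      = Real.exp (c * R) * (K + K * R) := by
    rw [e1, hK]; ring
  rw [e4] at hb
  have e5 : Real.exp (c * R) * (C + K + K * R) < Real.exp (c' * R) := by
    rw [e2]
    exact mul_lt_mul_of_pos_left hR2 (Real.exp_pos _)
  nlinarith

end Growth

theorem critExp_lower_semicontinuous (d : ℕ) (hd : 2 ≤ d)
    (Γs : ℕ → Subgroup (FreeGroup (Fin d))) (Γ : Subgroup (FreeGroup (Fin d)))
    (hconv : ChabautyTendsto Γs Γ) :
    critExp Γ ≤ Filter.atTop.liminf fun k => critExp (Γs k) := by
  have hcob : atTop.IsCoboundedUnder (· ≥ ·) fun k => critExp (Γs k) :=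
    (isBoundedUnder_of ⟨_, fun k => cx_crit_le (Γs k)⟩ :
      atTop.IsBoundedUnder (· ≤ ·) _).isCoboundedUnder_ge
  apply le_of_forall_lt
  intro c hc
  obtain ⟨c', h1, h2⟩ := exists_between hc
  refine h1.trans_le ?_
  apply le_liminf_of_le hcob
  rcases le_or_gt 0 c' with h0 | h0
  · obtain ⟨F, hF, hΔ⟩ := cx_key Γ c' h0 h2
    have : ∀ᶠ k in atTop, ∀ g ∈ F, (g ∈ Γs k ↔ g ∈ Γ) :=
      (Finset.eventually_all F).2 fun g _ => hconv g
    filter_upwards [this] with k hk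
    exact hΔ _ fun g hg => (hk g hg).2 (hF g hg)
  · exact Eventually.of_forall fun k => h0.le.trans (cx_crit_nonneg _)
end

section
/- Let d ≥ 2 and let Γ_1 ≤ Γ_2 ≤ Γ_3 ≤ … be a nondecreasing sequence of subgroups of F_d with union Γ = ⋃_k Γ_k. Then the sequence of critical exponents converges: lim_{k → ∞} δ(Γ_k) = δ(Γ). -/
open Filter

namespace CritExpAux

open FreeGroup

/-- Reduced words multiply by cancelling a common piece. -/
lemma exists_cancel {α : Type*} (A : List (α × Bool)) : ∀ b : List (α × Bool),
    IsReduced A → IsReduced b →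
    ∃ A' u B, A = A' ++ invRev u ∧ b = u ++ B ∧ IsReduced (A' ++ B) := by
  induction A using List.reverseRecOn with
  | nil => exact fun b _ hb => ⟨[], [], b, by simp, by simp, by simpa using hb⟩
  | append_singleton A p ih =>
    intro b hA hb
    cases b with
    | nil => exact ⟨A ++ [p], [], [], by simp, by simp, by simpa using hA⟩
    | cons q b =>
      by_cases hq : p.1 = q.1 → p.2 = q.2
      · refine ⟨A ++ [p], [], q :: b, by simp, by simp, ?_⟩
        refine List.IsChain.append hA hb ?_
        simpa using hq
      · obtain ⟨A', u, B, h1, h2, h3⟩ := ih b (List.IsChain.left_of_append hA)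
          (hb.infix ⟨[q], [], by simp⟩)
        refine ⟨A', q :: u, B, ?_, by simp [h2], h3⟩
        have : p = (q.1, !q.2) := by
          push Not at hq
          ext
          · exact hq.1
          · have := hq.2
            revert this
            cases p.2 <;> cases q.2 <;> simp
        rw [h1, this, invRev_cons]
        simp [invRev]

lemma mul_cancel_exists {α : Type*} [DecidableEq α] (g h : FreeGroup α) :
    ∃ A u B, g.toWord = A ++ invRev u ∧ h.toWord = u ++ B ∧ (g * h).toWord = A ++ B := by
  obtain ⟨A, u, B, h1, h2, h3⟩ := exists_cancel g.toWord h.toWord isReduced_toWord isReduced_toWord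
  refine ⟨A, u, B, h1, h2, ?_⟩
  have : g * h = mk (A ++ B) := by
    rw [← mk_toWord (x := g), ← mk_toWord (x := h), h1, h2, ← mul_mk, ← mul_mk, ← mul_mk,
      ← inv_mk]
    group
  rw [this, toWord_mk, h3.reduce_eq]

lemma ball_finite (d R : ℕ) : {g : FreeGroup (Fin d) | norm g ≤ R}.Finite :=
  Set.Finite.preimage toWord_injective.injOn (List.finite_length_le (Fin d × Bool) R)

lemma gset_finite {d : ℕ} (Γ : Subgroup (FreeGroup (Fin d))) (R : ℕ) :
    {g | g ∈ Γ ∧ norm g ≤ R}.Finite :=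
  (ball_finite d R).subset fun _ h => h.2

/-- The elements of `Γ` of norm at most `R`, as a finset. -/
noncomputable def gball {d : ℕ} (Γ : Subgroup (FreeGroup (Fin d))) (R : ℕ) :
    Finset (FreeGroup (Fin d)) :=
  (gset_finite Γ R).toFinset

lemma mem_gball {d : ℕ} {Γ : Subgroup (FreeGroup (Fin d))} {R : ℕ} {g : FreeGroup (Fin d)} :
    g ∈ gball Γ R ↔ g ∈ Γ ∧ norm g ≤ R := by
  simp [gball]

lemma growthCount_eq {d : ℕ} (Γ : Subgroup (FreeGroup (Fin d))) (R : ℕ) :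
    growthCount Γ R = (gball Γ R).card := by
  have := Nat.card_eq_card_finite_toFinset (gset_finite Γ R)
  exact this

/-- Large balls move every point out of every cone of depth `L`. -/
lemma exists_move {d : ℕ} (Γ : Subgroup (FreeGroup (Fin d))) (L : ℕ)
    (h : (L + 1) ^ 2 < (gball Γ L).card) (v : FreeGroup (Fin d)) (x : List (Fin d × Bool)) :
    ∃ t ∈ gball Γ L, (t * v).toWord.take L ≠ x := by
  classical
  by_contra! hcon
  have h1 : v.toWord.take L = x := by
    simpa using hcon 1 (by simp [mem_gball])
  have hsub : gball Γ L ⊆ (Finset.range (L + 1) ×ˢ Finset.range (L + 1)).image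
      fun p : ℕ × ℕ => mk (x.take p.1 ++ invRev (x.take p.2)) := by
    intro t ht
    have ht2 := hcon t ht
    obtain ⟨z, u, B, e1, e2, e3⟩ := mul_cancel_exists t v
    have hl : z.length + u.length ≤ L := by
      have := (mem_gball.1 ht).2
      rw [FreeGroup.norm, e1] at this
      simpa using this
    rw [Finset.mem_image]
    refine ⟨(z.length, u.length), by simp; omega, ?_⟩
    have hz : x.take z.length = z := by
      rw [← ht2, e3, List.take_take, min_eq_left (by omega), List.take_left]
    have hu : x.take u.length = u := by
      rw [← h1, e2, List.take_take, min_eq_left (by omega), List.take_left]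
    simp only [hz, hu]
    rw [← e1, mk_toWord]
  have := (Finset.card_le_card hsub).trans Finset.card_image_le
  simp at this
  nlinarith

/-- If the prefix of `g⁻¹` differs from that of `h`, then `g * h` keeps most of `g`. -/
lemma take_mul {d : ℕ} (g h : FreeGroup (Fin d)) (L : ℕ)
    (hne : (g⁻¹).toWord.take L ≠ h.toWord.take L) :
    (g * h).toWord.take (norm g - L) = g.toWord.take (norm g - L) := by
  obtain ⟨A, u, B, e1, e2, e3⟩ := mul_cancel_exists g h
  have hu : u.length < L := by
    by_contra! hu
    apply hne
    rw [toWord_inv, e1, e2, invRev_append, invRev_invRev, List.take_append_of_le_length hu,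
      List.take_append_of_le_length hu]
  have : norm g - L ≤ A.length := by
    rw [FreeGroup.norm, e1]; simp; omega
  rw [e3, e1, List.take_append_of_le_length this, List.take_append_of_le_length this]

lemma take_mul_short {d : ℕ} (g h : FreeGroup (Fin d)) (L : ℕ) (hh : norm h ≤ L)
    (hg : 2 * L ≤ norm g) : (g * h).toWord.take L = g.toWord.take L := by
  obtain ⟨A, u, B, e1, e2, e3⟩ := mul_cancel_exists g h
  have : L ≤ A.length := by
    rw [FreeGroup.norm, e1] at hg
    rw [FreeGroup.norm, e2] at hh
    simp at hg hh; omega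
  rw [e3, e1, List.take_append_of_le_length this, List.take_append_of_le_length this]

/-- A set of elements of equal norm with common incompatible ends freely generates a
free monoid. -/
lemma pow_card_le {d : ℕ} (Γ : Subgroup (FreeGroup (Fin d))) (L m : ℕ) (hL : 1 ≤ L)
    (hm : 2 * L ≤ m) (x x' : List (Fin d × Bool)) (hx : x ≠ x')
    (Y : Finset (FreeGroup (Fin d))) (hY : ∀ y ∈ Y, y ∈ Γ ∧ norm y = m ∧
      y.toWord.take L = x ∧ (y⁻¹).toWord.take L = x') (hne : Y.Nonempty) (j : ℕ) :
    ∃ P : Finset (FreeGroup (Fin d)), P.card = Y.card ^ j ∧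
      ∀ g ∈ P, g ∈ Γ ∧ norm g ≤ j * m ∧ g.toWord.take L ≠ x' := by
  classical
  induction j with
  | zero =>
    refine ⟨{1}, by simp, ?_⟩
    obtain ⟨y, hy⟩ := hne
    obtain ⟨-, h2, -, h4⟩ := hY y hy
    simp only [Finset.mem_singleton, forall_eq, one_mem, FreeGroup.norm_one, toWord_one, List.take_nil]
    refine ⟨trivial, by simp, ?_⟩
    rw [← h4]
    intro h
    have := congrArg List.length h
    rw [← norm_inv_eq, FreeGroup.norm] at h2
    rw [List.length_take, h2, List.length_nil] at this
    omega
  | succ j ih =>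
    obtain ⟨P, hP, hP2⟩ := ih
    have key : ∀ y ∈ Y, ∀ g ∈ P, (y * g).toWord.take (m - L) = y.toWord.take (m - L) := by
      intro y hy g hg
      obtain ⟨-, h2, -, h4⟩ := hY y hy
      have := take_mul y g L (by rw [h4]; exact (hP2 g hg).2.2.symm)
      rwa [h2] at this
    refine ⟨(Y ×ˢ P).image fun p => p.1 * p.2, ?_, ?_⟩
    · rw [Finset.card_image_of_injOn, Finset.card_product, hP, pow_succ, mul_comm]
      rintro ⟨y, g⟩ h1 ⟨y', g'⟩ h2 heq
      simp only [Finset.coe_product, Set.mem_prod, Finset.mem_coe] at h1 h2 heq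
      have e1 := key y h1.1 g h1.2
      have e2 := key y' h2.1 g' h2.2
      rw [heq, e2] at e1
      have hyy : y = y' := by
        obtain ⟨-, n1, -, q1⟩ := hY y h1.1
        obtain ⟨-, n2, -, q2⟩ := hY y' h2.1
        have hd : y.toWord.drop (m - L) = y'.toWord.drop (m - L) := by
          have hh := q1.trans q2.symm
          apply invRev_injective
          rw [FreeGroup.norm] at n1 n2
          have aux : ∀ w : List (Fin d × Bool), w.length = m →
              invRev (w.drop (m - L)) = (invRev w).take L := by
            intro w hw
            have h3 : invRev w = invRev (w.drop (m - L)) ++ invRev (w.take (m - L)) := by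
              rw [← invRev_append, List.take_append_drop]
            rw [h3, List.take_left']
            simp; omega
          rw [aux _ n1, aux _ n2, ← toWord_inv, ← toWord_inv, hh]
        apply toWord_injective
        rw [← List.take_append_drop (m - L) y.toWord, ← e1, hd, List.take_append_drop]
      subst hyy
      simpa using heq
    · intro z hz
      obtain ⟨⟨y, g⟩, hp, rfl⟩ := Finset.mem_image.1 hz
      obtain ⟨hy, hg⟩ := Finset.mem_product.1 hp
      simp only at hy hg ⊢
      obtain ⟨h1, h2, h3, h4⟩ := hY y hy
      obtain ⟨g1, g2, g3⟩ := hP2 g hg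
      refine ⟨mul_mem h1 g1, ?_, ?_⟩
      · have := norm_mul_le y g
        rw [h2] at this
        linarith [add_mul j 1 m]
      · have := congrArg (List.take L) (key y hy g hg)
        rw [List.take_take, List.take_take, min_eq_left (by omega), h3] at this
        rwa [this]

/-- Pigeonhole: a large ball of `Γ` contains many elements with common incompatible ends. -/
lemma exists_good {d : ℕ} (Γ : Subgroup (FreeGroup (Fin d))) (L : ℕ)
    (h : (L + 1) ^ 2 < (gball Γ L).card) :
    ∃ K C : ℕ, ∀ R n : ℕ, K + C * (R + L + 1) * n < (gball Γ R).card →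
      ∃ (m : ℕ) (x x' : List (Fin d × Bool)) (Y : Finset (FreeGroup (Fin d))),
        2 * L ≤ m ∧ m ≤ R + L ∧ x ≠ x' ∧
        (∀ y ∈ Y, y ∈ Γ ∧ FreeGroup.norm y = m ∧ y.toWord.take L = x ∧
          (y⁻¹).toWord.take L = x') ∧ n < Y.card := by
  classical
  have hw : ∀ w : FreeGroup (Fin d), ∃ t ∈ gball Γ L,
      (t * w⁻¹).toWord.take L ≠ w.toWord.take L := fun w => exists_move Γ L h _ _
  choose t ht htw using hw
  let W : Finset (List (Fin d × Bool)) := (List.finite_length_le (Fin d × Bool) L).toFinset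
  have hW : ∀ l : List (Fin d × Bool), l.take L ∈ W := by
    intro l; simp [W]
  refine ⟨(gball Γ (3 * L)).card, (gball Γ L).card * (W.card * W.card), fun R n hn => ?_⟩
  let S := (gball Γ R).filter fun w => 3 * L ≤ FreeGroup.norm w
  have hS : (gball Γ R).card ≤ (gball Γ (3 * L)).card + S.card := by
    refine (Finset.card_le_card ?_).trans (Finset.card_union_le _ _)
    intro w hw
    rw [Finset.mem_union]
    by_cases h3 : 3 * L ≤ FreeGroup.norm w
    · exact Or.inr (Finset.mem_filter.2 ⟨hw, h3⟩)
    · exact Or.inl (mem_gball.2 ⟨(mem_gball.1 hw).1, by omega⟩)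
  let y : FreeGroup (Fin d) → FreeGroup (Fin d) := fun w => w * (t w)⁻¹
  let φ : FreeGroup (Fin d) → (FreeGroup (Fin d) × ℕ) ×
      (List (Fin d × Bool) × List (Fin d × Bool)) := fun w =>
    ((t w, FreeGroup.norm (y w)), ((y w).toWord.take L, ((y w)⁻¹).toWord.take L))
  let T := (gball Γ L ×ˢ Finset.range (R + L + 1)) ×ˢ (W ×ˢ W)
  have hmaps : ∀ w ∈ S, φ w ∈ T := by
    intro w hw
    have h1 := (mem_gball.1 (Finset.mem_filter.1 hw).1).2
    have h2 := (mem_gball.1 (ht w)).2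
    have h3 := FreeGroup.norm_mul_le w (t w)⁻¹
    rw [FreeGroup.norm_inv_eq] at h3
    simp only [T, φ, Finset.mem_product, Finset.mem_range]
    exact ⟨⟨ht w, by change FreeGroup.norm (w * (t w)⁻¹) < _; omega⟩, hW _, hW _⟩
  have hT : T.card * n < S.card := by
    have : T.card = (gball Γ L).card * (W.card * W.card) * (R + L + 1) := by
      simp only [T, Finset.card_product, Finset.card_range]; ring
    rw [this]; omega
  obtain ⟨⟨⟨t0, m⟩, x, x'⟩, -, hfib⟩ :=
    Finset.exists_lt_card_fiber_of_mul_lt_card_of_maps_to hmaps hT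
  have hfibmem : ∀ w ∈ S.filter (fun w => φ w = ((t0, m), x, x')),
      w ∈ S ∧ t w = t0 ∧ FreeGroup.norm (y w) = m ∧ (y w).toWord.take L = x ∧
        ((y w)⁻¹).toWord.take L = x' := by
    intro w hw
    obtain ⟨h1, h2⟩ := Finset.mem_filter.1 hw
    simp only [φ, Prod.mk.injEq] at h2
    exact ⟨h1, h2.1.1, h2.1.2, h2.2.1, h2.2.2⟩
  have hyS : ∀ w ∈ S, y w ∈ Γ ∧ 2 * L ≤ FreeGroup.norm (y w) ∧ FreeGroup.norm (y w) ≤ R + L ∧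
      (y w).toWord.take L ≠ ((y w)⁻¹).toWord.take L := by
    intro w hw
    obtain ⟨h0, h3⟩ := Finset.mem_filter.1 hw
    obtain ⟨h0, h1⟩ := mem_gball.1 h0
    obtain ⟨h4, h5⟩ := mem_gball.1 (ht w)
    have h6 := Finset.mem_product.1 (hmaps w hw)
    have h7 := Finset.mem_range.1 (Finset.mem_product.1 h6.1).2
    refine ⟨mul_mem h0 (inv_mem h4), ?_, ?_, ?_⟩
    · have h8 := FreeGroup.norm_mul_le (y w) (t w)
      have h9 : y w * t w = w := by simp [y]
      rw [h9] at h8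
      omega
    · simp only [φ] at h7
      omega
    · have e1 : (y w).toWord.take L = w.toWord.take L :=
        take_mul_short w (t w)⁻¹ L (by rwa [FreeGroup.norm_inv_eq]) (by omega)
      have e2 : (y w)⁻¹ = t w * w⁻¹ := by simp [y]
      rw [e1, e2]
      exact (htw w).symm
  obtain ⟨w0, hw0⟩ := Finset.card_pos.1 (Nat.zero_lt_of_lt hfib)
  obtain ⟨a1, a2, a3, a4, a5⟩ := hfibmem w0 hw0
  obtain ⟨b1, b2, b3, b4⟩ := hyS w0 a1
  refine ⟨m, x, x', (S.filter (fun w => φ w = ((t0, m), x, x'))).image y, by omega, by omega,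
    by rwa [a4, a5] at b4, ?_, ?_⟩
  · intro z hz
    obtain ⟨w, hw, rfl⟩ := Finset.mem_image.1 hz
    obtain ⟨c1, c2, c3, c4, c5⟩ := hfibmem w hw
    exact ⟨(hyS w c1).1, c3, c4, c5⟩
  · rwa [Finset.card_image_of_injOn]
    intro w hw w' hw' heq
    have c := (hfibmem w hw).2.1
    have c' := (hfibmem w' hw').2.1
    simp only [y, c, c'] at heq
    exact mul_right_cancel heq

lemma card_gball_le {d : ℕ} (Γ : Subgroup (FreeGroup (Fin d))) (R : ℕ) :
    (gball Γ R).card ≤ (2 * d + 1) ^ R := by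
  classical
  have : (gball Γ R).card ≤ (Finset.univ : Finset (Fin R → Option (Fin d × Bool))).card := by
    refine Finset.card_le_card_of_injOn (fun g i => g.toWord[(i : ℕ)]?) (by simp) ?_
    intro g hg g' hg' heq
    have h1 := (mem_gball.1 hg).2
    have h2 := (mem_gball.1 hg').2
    apply toWord_injective
    apply List.ext_getElem?
    intro i
    by_cases hi : i < R
    · exact congrFun heq ⟨i, hi⟩
    · rw [FreeGroup.norm] at h1 h2
      rw [List.getElem?_eq_none (by omega), List.getElem?_eq_none (by omega)]
  simpa [mul_comm] using this

lemma one_le_card_gball {d : ℕ} (Γ : Subgroup (FreeGroup (Fin d))) (R : ℕ) :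
    1 ≤ (gball Γ R).card :=
  Finset.card_pos.2 ⟨1, mem_gball.2 ⟨one_mem _, by simp⟩⟩

/-- The sequence whose limsup is the critical exponent. -/
noncomputable def rate {d : ℕ} (Γ : Subgroup (FreeGroup (Fin d))) (R : ℕ) : ℝ :=
  Real.log (growthCount Γ R : ℝ) / (R : ℝ)

lemma critExp_eq {d : ℕ} (Γ : Subgroup (FreeGroup (Fin d))) :
    critExp Γ = limsup (rate Γ) atTop := rfl

lemma rate_nonneg {d : ℕ} (Γ : Subgroup (FreeGroup (Fin d))) (R : ℕ) : 0 ≤ rate Γ R := by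
  refine div_nonneg (Real.log_nonneg ?_) (by positivity)
  rw [growthCount_eq]
  exact_mod_cast one_le_card_gball Γ R

lemma rate_le {d : ℕ} (Γ : Subgroup (FreeGroup (Fin d))) (R : ℕ) :
    rate Γ R ≤ Real.log (2 * d + 1) := by
  have h0 : 0 ≤ Real.log (2 * (d : ℝ) + 1) := Real.log_nonneg (by linarith [d.cast_nonneg (α := ℝ)])
  refine div_le_of_le_mul₀ (by positivity) h0 ?_
  rw [mul_comm, ← Real.log_pow, growthCount_eq]
  refine Real.log_le_log (by exact_mod_cast one_le_card_gball Γ R) ?_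
  exact_mod_cast card_gball_le Γ R

lemma rate_bdd {d : ℕ} (Γ : Subgroup (FreeGroup (Fin d))) :
    IsBoundedUnder (· ≤ ·) atTop (rate Γ) :=
  isBoundedUnder_of ⟨_, rate_le Γ⟩

lemma rate_cobdd {d : ℕ} (Γ : Subgroup (FreeGroup (Fin d))) :
    IsCoboundedUnder (· ≤ ·) atTop (rate Γ) :=
  (isBoundedUnder_of ⟨0, rate_nonneg Γ⟩ : IsBoundedUnder (· ≥ ·) atTop (rate Γ)).isCoboundedUnder_le

lemma critExp_mono {d : ℕ} {Γ Γ' : Subgroup (FreeGroup (Fin d))} (h : Γ ≤ Γ') :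
    critExp Γ ≤ critExp Γ' := by
  rw [critExp_eq, critExp_eq]
  refine limsup_le_limsup (Eventually.of_forall fun R => ?_) (rate_cobdd _) (rate_bdd _)
  refine div_le_div_of_nonneg_right (Real.log_le_log ?_ ?_) (by positivity)
  · rw [growthCount_eq]; exact_mod_cast one_le_card_gball Γ R
  · rw [growthCount_eq, growthCount_eq]
    exact_mod_cast Finset.card_le_card fun g hg =>
      mem_gball.2 ⟨h (mem_gball.1 hg).1, (mem_gball.1 hg).2⟩

lemma critExp_nonneg {d : ℕ} (Γ : Subgroup (FreeGroup (Fin d))) : 0 ≤ critExp Γ :=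
  le_limsup_of_frequently_le (Frequently.of_forall (rate_nonneg Γ)) (rate_bdd Γ)

lemma le_critExp {d : ℕ} (Γ : Subgroup (FreeGroup (Fin d))) (L m : ℕ) (hL : 1 ≤ L)
    (hm : 2 * L ≤ m) (x x' : List (Fin d × Bool)) (hx : x ≠ x')
    (Y : Finset (FreeGroup (Fin d))) (hY : ∀ y ∈ Y, y ∈ Γ ∧ FreeGroup.norm y = m ∧
      y.toWord.take L = x ∧ (y⁻¹).toWord.take L = x') (hne : Y.Nonempty) :
    Real.log Y.card / m ≤ critExp Γ := by
  rw [critExp_eq]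
  refine le_limsup_of_frequently_le ?_ (rate_bdd Γ)
  rw [frequently_atTop]
  intro a
  refine ⟨(a + 1) * m, by nlinarith, ?_⟩
  obtain ⟨P, hP, hP2⟩ := pow_card_le Γ L m hL hm x x' hx Y hY hne (a + 1)
  have hle : Y.card ^ (a + 1) ≤ (gball Γ ((a + 1) * m)).card := by
    rw [← hP]
    exact Finset.card_le_card fun g hg => mem_gball.2 ⟨(hP2 g hg).1, (hP2 g hg).2.1⟩
  have hY0 : 0 < Y.card := Finset.card_pos.2 hne
  have hlog : ((a + 1 : ℕ) : ℝ) * Real.log Y.card ≤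
      Real.log (growthCount Γ ((a + 1) * m) : ℝ) := by
    rw [← Real.log_pow, growthCount_eq]
    exact Real.log_le_log (by positivity) (by exact_mod_cast hle)
  have hm0 : (0 : ℝ) < m := by exact_mod_cast (by omega : 0 < m)
  have ha0 : (0 : ℝ) < ((a + 1 : ℕ) : ℝ) := by positivity
  rw [rate, div_le_div_iff₀ hm0 (by push_cast; positivity)]
  push_cast at hlog ⊢
  nlinarith

lemma exists_lt_critExp {d : ℕ} (Γs : ℕ → Subgroup (FreeGroup (Fin d))) (hmono : Monotone Γs)
    (Γ : Subgroup (FreeGroup (Fin d)))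
    (hunion : (⋃ k, (Γs k : Set (FreeGroup (Fin d)))) = (Γ : Set (FreeGroup (Fin d))))
    (s : ℝ) (hs0 : 0 < s) (hs : s < critExp Γ) : ∃ k, s ≤ critExp (Γs k) := by
  classical
  obtain ⟨s', hs1, hs2⟩ := exists_between hs
  have hsq : 0 < s' := hs0.trans hs1
  rw [critExp_eq] at hs2
  have hfreq := frequently_lt_of_lt_limsup (rate_cobdd Γ) hs2
  have hbig : ∀ u : ℕ → ℝ, (∀ᶠ R : ℕ in atTop, u R < Real.exp (s' * R)) →
      ∃ R : ℕ, 1 ≤ R ∧ u R < (gball Γ R).card := by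
    intro u hu
    obtain ⟨R, h1, h2, h3⟩ := (hfreq.and_eventually (hu.and (eventually_ge_atTop 1))).exists
    refine ⟨R, h3, h2.trans_le ?_⟩
    have hR : (0 : ℝ) < R := by exact_mod_cast h3
    rw [rate, lt_div_iff₀ hR, growthCount_eq] at h1
    rw [← Real.exp_log (show (0 : ℝ) < (gball Γ R).card by
      exact_mod_cast one_le_card_gball Γ R)]
    exact Real.exp_le_exp.2 h1.le
  have hlim : ∀ c : ℝ, 0 < c → ∀ k : ℕ,
      Tendsto (fun R : ℕ => (R : ℝ) ^ k * Real.exp (-(c * R))) atTop (nhds 0) := by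
    intro c hc k
    have h1 := (Real.tendsto_pow_mul_exp_neg_atTop_nhds_zero k).comp
      ((tendsto_natCast_atTop_atTop (R := ℝ)).const_mul_atTop hc)
    have h2 := h1.const_mul ((c ^ k)⁻¹)
    rw [mul_zero] at h2
    refine h2.congr fun R => ?_
    simp only [Function.comp]
    rw [mul_pow]
    field_simp
  obtain ⟨L, hL, hLc⟩ := hbig (fun R => ((R : ℝ) + 1) ^ 2) (by
    have h0 := ((hlim s' hsq 2).add ((hlim s' hsq 1).const_mul 2)).add (hlim s' hsq 0)
    simp only [mul_zero, add_zero] at h0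
    filter_upwards [h0.eventually_lt_const one_pos] with R hR
    have hE := Real.exp_pos (s' * R)
    have hprod : Real.exp (-(s' * R)) * Real.exp (s' * R) = 1 := by
      rw [← Real.exp_add]; simp
    have := mul_lt_mul_of_pos_right hR hE
    calc ((R : ℝ) + 1) ^ 2 = ((R : ℝ) + 1) ^ 2 * (Real.exp (-(s' * R)) * Real.exp (s' * R)) := by
          rw [hprod, mul_one]
      _ = _ := by ring
      _ < _ := this
      _ = _ := one_mul _)
  obtain ⟨K, C, hKC⟩ := exists_good Γ L (by exact_mod_cast hLc)
  obtain ⟨R, hR1, hRc⟩ := hbig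
    (fun R => K + C * (R + L + 1) * Real.exp (s * (R + L))) (by
    have hc : 0 < s' - s := by linarith
    have h0 := ((hlim s' hsq 0).const_mul (K : ℝ)).add
      (((hlim _ hc 1).const_mul (C * Real.exp (s * L))).add
        ((hlim _ hc 0).const_mul (C * (L + 1) * Real.exp (s * L))))
    simp only [mul_zero, add_zero] at h0
    filter_upwards [h0.eventually_lt_const one_pos] with R hR
    have hE := Real.exp_pos (s' * R)
    have hprod : Real.exp (-(s' * R)) * Real.exp (s' * R) = 1 := by
      rw [← Real.exp_add]; simp
    have hprod2 : Real.exp (-((s' - s) * R)) * Real.exp (s' * R) = Real.exp (s * R) := by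
      rw [← Real.exp_add]; ring_nf
    have := mul_lt_mul_of_pos_right hR hE
    have hsum : Real.exp (s * (R + L)) = Real.exp (s * R) * Real.exp (s * L) := by
      rw [← Real.exp_add]; ring_nf
    calc (K : ℝ) + C * (R + L + 1) * Real.exp (s * (R + L))
        = K * (Real.exp (-(s' * R)) * Real.exp (s' * R)) + C * (R + L + 1) *
          ((Real.exp (-((s' - s) * R)) * Real.exp (s' * R)) * Real.exp (s * L)) := by
          rw [hprod, hprod2, hsum, mul_one]
      _ = _ := by ring
      _ < _ := this
      _ = _ := one_mul _)
  obtain ⟨m, x, x', Y, hm1, hm2, hx, hY, hn⟩ := hKC R ⌊Real.exp (s * (R + L))⌋₊ (by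
    have hfl := Nat.floor_le (Real.exp_pos (s * (R + L))).le
    have : ((K + C * (R + L + 1) * ⌊Real.exp (s * (R + L))⌋₊ : ℕ) : ℝ) < (gball Γ R).card := by
      refine lt_of_le_of_lt ?_ hRc
      push_cast
      gcongr
    exact_mod_cast this)
  have hYe : Real.exp (s * (R + L)) < Y.card := (Nat.floor_lt (Real.exp_pos _).le).1 hn
  have hne : Y.Nonempty := Finset.card_pos.1 (Nat.zero_lt_of_lt hn)
  have hmem : ∀ y ∈ Y, ∃ k, y ∈ Γs k := by
    intro y hy
    have : y ∈ (Γ : Set (FreeGroup (Fin d))) := (hY y hy).1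
    rw [← hunion] at this
    simpa using this
  choose! κ hκ using hmem
  refine ⟨Y.sup κ, ?_⟩
  refine le_trans ?_ (le_critExp (Γs (Y.sup κ)) L m hL hm1 x x' hx Y
    (fun y hy => ⟨hmono (Finset.le_sup hy) (hκ y hy), (hY y hy).2⟩) hne)
  have hm0 : (0 : ℝ) < m := by exact_mod_cast (by omega : 0 < m)
  rw [le_div_iff₀ hm0]
  have hlog := (Real.lt_log_iff_exp_lt ((Real.exp_pos _).trans hYe)).2 hYe
  have hmR : (m : ℝ) ≤ R + L := by exact_mod_cast hm2
  nlinarith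

end CritExpAux

theorem critExp_tendsto_of_monotone_union (d : ℕ) (hd : 2 ≤ d)
    (Γs : ℕ → Subgroup (FreeGroup (Fin d))) (hmono : Monotone Γs)
    (Γ : Subgroup (FreeGroup (Fin d))) (hunion : (⋃ k, (Γs k : Set (FreeGroup (Fin d)))) = (Γ : Set (FreeGroup (Fin d)))) :
    Filter.Tendsto (fun k => critExp (Γs k)) Filter.atTop (nhds (critExp Γ)) := by
  have hle : ∀ k, Γs k ≤ Γ := by
    intro k g hg
    have : g ∈ (Γ : Set (FreeGroup (Fin d))) := by
      rw [← hunion]; exact Set.mem_iUnion.2 ⟨k, hg⟩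
    exact this
  refine tendsto_atTop_isLUB (fun i j hij => CritExpAux.critExp_mono (hmono hij)) ⟨?_, ?_⟩
  · rintro _ ⟨k, rfl⟩
    exact CritExpAux.critExp_mono (hle k)
  · intro b hb
    have hb' : ∀ k, critExp (Γs k) ≤ b := fun k => hb ⟨k, rfl⟩
    by_contra! hlt
    obtain ⟨s, hs1, hs2⟩ := exists_between hlt
    have hs0 : 0 < s := ((CritExpAux.critExp_nonneg (Γs 0)).trans (hb' 0)).trans_lt hs1
    obtain ⟨k, hk⟩ := CritExpAux.exists_lt_critExp Γs hmono Γ hunion s hs0 hs2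
    linarith [hb' k]
end

section
/- Let d ≥ 2 and let Δ be a subgroup of F_d with δ(Δ) ≤ log(2d−1)/2. Then Δ is not confined: there exists a sequence (g_n) in F_d such that the conjugates g_n Δ g_n^{-1} Chabauty-converge to the trivial subgroup, i.e. for every h ≠ 1 in F_d, eventually g_n^{-1} h g_n ∉ Δ. -/
open Filter

namespace NC

variable {d : ℕ}

/-- The letter as a group element. -/
def lt (a : Fin d × Bool) : FreeGroup (Fin d) := FreeGroup.mk [a]

/-- Inverse letter. -/
def ia (a : Fin d × Bool) : Fin d × Bool := (a.1, !a.2)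

theorem ia_ia (a : Fin d × Bool) : ia (ia a) = a := by simp [ia]

theorem lt_ia (a : Fin d × Bool) : lt (ia a) = (lt a)⁻¹ := by
  simp [lt, ia, FreeGroup.inv_mk, FreeGroup.invRev]

theorem lt_ia_mul (a : Fin d × Bool) (x : FreeGroup (Fin d)) : lt (ia a) * (lt a * x) = x := by
  rw [lt_ia]; group

theorem lt_mul_ia (a : Fin d × Bool) (x : FreeGroup (Fin d)) : lt a * (lt (ia a) * x) = x := by
  rw [lt_ia]; group

theorem toWord_lt_mul (a : Fin d × Bool) (x : FreeGroup (Fin d)) :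
    (lt a * x).toWord = FreeGroup.reduce (a :: x.toWord) := by
  conv_lhs => rw [← FreeGroup.mk_toWord (x := x)]
  simp [lt, FreeGroup.mul_mk]

theorem norm_lt_mul_ne {x : FreeGroup (Fin d)} {b : Fin d × Bool} {L : List (Fin d × Bool)}
    (h : x.toWord = b :: L) (a : Fin d × Bool) (ha : a ≠ ia b) :
    (lt a * x).norm = x.norm + 1 := by
  have h1 : FreeGroup.reduce (b :: L) = b :: L := by rw [← h, FreeGroup.reduce_toWord]
  have h2 : ¬ (a.1 = b.1 ∧ a.2 = !b.2) := fun h => ha (Prod.ext h.1 h.2)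
  unfold FreeGroup.norm
  rw [toWord_lt_mul, h, FreeGroup.reduce.cons, h1]
  simp [h2]

theorem norm_lt_mul_eq {x : FreeGroup (Fin d)} {b : Fin d × Bool} {L : List (Fin d × Bool)}
    (h : x.toWord = b :: L) : (lt (ia b) * x).norm = x.norm - 1 := by
  have h1 : FreeGroup.reduce (b :: L) = b :: L := by rw [← h, FreeGroup.reduce_toWord]
  unfold FreeGroup.norm
  rw [toWord_lt_mul, h, FreeGroup.reduce.cons, h1]
  simp [ia]

theorem nbr {x : FreeGroup (Fin d)} (hx : x ≠ 1) (f : ℕ → ℝ) :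
    ∑ a : Fin d × Bool, f (lt a * x).norm = (2 * (d : ℝ) - 1) * f (x.norm + 1) + f (x.norm - 1) := by
  obtain ⟨b, L, h⟩ : ∃ b L, x.toWord = b :: L := by
    cases h : x.toWord with
    | nil => exact absurd (FreeGroup.toWord_eq_nil_iff.1 h) hx
    | cons b L => exact ⟨b, L, rfl⟩
  rw [← Finset.add_sum_erase _ _ (Finset.mem_univ (ia b)), norm_lt_mul_eq h]
  rw [Finset.sum_congr rfl (g := fun _ => f (x.norm + 1))]
  · rw [Finset.sum_const, Finset.card_erase_of_mem (Finset.mem_univ _)]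
    have : 0 < d := Fin.pos b.1
    simp only [Finset.card_univ, Fintype.card_prod, Fintype.card_fin, Fintype.card_bool, nsmul_eq_mul]
    rw [Nat.cast_sub (by omega)]
    push_cast; ring
  · intro a ha
    rw [norm_lt_mul_ne h a (Finset.ne_of_mem_erase ha)]

theorem norm_lt (a : Fin d × Bool) : (lt a * 1).norm = 1 := by
  simp [lt, FreeGroup.norm]

theorem nbr_one (f : ℕ → ℝ) :
    ∑ a : Fin d × Bool, f (lt a * 1).norm = 2 * (d : ℝ) * f 1 := by
  simp only [norm_lt]
  simp only [Finset.sum_const, Finset.card_univ, Fintype.card_prod, Fintype.card_fin, Fintype.card_bool, nsmul_eq_mul]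
  push_cast; ring

theorem norm_le_lt_mul (a : Fin d × Bool) (x : FreeGroup (Fin d)) :
    x.norm ≤ (lt a * x).norm + 1 := by
  have h := FreeGroup.norm_mul_le (lt (ia a)) (lt a * x)
  rw [lt_ia_mul] at h
  have := norm_lt (ia a)
  rw [mul_one] at this
  omega

theorem decomp (K X : List (Fin d × Bool)) (hK : FreeGroup.IsReduced K)
    (hX : FreeGroup.IsReduced X) :
    ∃ C B A, K = C ++ B ∧ X = FreeGroup.invRev B ++ A ∧ FreeGroup.IsReduced (C ++ A) := by
  induction K using List.reverseRecOn generalizing X with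
  | nil => exact ⟨[], [], X, by simp, by simp [FreeGroup.invRev], by simpa using hX⟩
  | append_singleton K y ih =>
    cases X with
    | nil => exact ⟨K ++ [y], [], [], by simp, by simp [FreeGroup.invRev], by simpa using hK⟩
    | cons z X =>
      by_cases hyz : y.1 = z.1 → y.2 = z.2
      · refine ⟨K ++ [y], [], z :: X, by simp, by simp [FreeGroup.invRev], ?_⟩
        unfold FreeGroup.IsReduced at *
        rw [List.isChain_append]
        refine ⟨hK, hX, ?_⟩
        simpa using hyz
      · push Not at hyz
        obtain ⟨C, B, A, h1, h2, h3⟩ := ih X (hK.infix ⟨[], [y], by simp⟩) (hX.infix ⟨[z], [], by simp⟩)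
        refine ⟨C, B ++ [y], A, by simp [h1], ?_, h3⟩
        have : z = (y.1, !y.2) := by
          refine Prod.ext hyz.1.symm ?_
          have := hyz.2
          revert this
          cases y.2 <;> cases z.2 <;> simp
        rw [h2, this]
        simp [FreeGroup.invRev]

theorem decomp_group (k x : FreeGroup (Fin d)) :
    ∃ C B A, k.toWord = C ++ B ∧ x.toWord = FreeGroup.invRev B ++ A ∧ (k * x).toWord = C ++ A := by
  obtain ⟨C, B, A, h1, h2, h3⟩ := decomp k.toWord x.toWord FreeGroup.isReduced_toWord
    FreeGroup.isReduced_toWord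
  refine ⟨C, B, A, h1, h2, ?_⟩
  have : k * x = FreeGroup.mk (C ++ A) := by
    rw [← FreeGroup.mk_toWord (x := k), ← FreeGroup.mk_toWord (x := x), h1, h2]
    simp only [← FreeGroup.mul_mk, ← FreeGroup.inv_mk]
    group
  rw [this, FreeGroup.toWord_mk, h3.reduce_eq]

theorem norm_ne {k : FreeGroup (Fin d)} (hk : k ≠ 1) (x : FreeGroup (Fin d)) :
    (k * x).norm ≠ x.norm ∨ (k * k * x).norm ≠ x.norm := by
  by_contra! hcon
  obtain ⟨h1, h2⟩ := hcon
  obtain ⟨C, B, A, a1, a2, a3⟩ := decomp_group k x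
  obtain ⟨C', B', A', b1, b2, b3⟩ := decomp_group k (k * x)
  rw [mul_assoc] at h2
  simp only [FreeGroup.norm, a2, a3, b3, List.length_append, FreeGroup.invRev_length] at h1 h2
  have e1 := congrArg List.length (a1.symm.trans b1)
  have e2 := congrArg List.length (a3.symm.trans b2)
  simp only [List.length_append, FreeGroup.invRev_length] at e1 e2
  obtain ⟨hC, hB⟩ := List.append_inj (a1.symm.trans b1) (by omega)
  obtain ⟨hC', -⟩ := List.append_inj (a3.symm.trans b2) (by simp; omega)
  apply hk
  rw [← FreeGroup.mk_toWord (x := k), a1, hC', ← FreeGroup.mul_mk, ← FreeGroup.inv_mk, hB]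
  group

theorem ball_finite (R : ℕ) : {x : FreeGroup (Fin d) | x.norm ≤ R}.Finite :=
  (List.finite_length_le (Fin d × Bool) R).preimage FreeGroup.toWord_injective.injOn

theorem sa (h : FreeGroup (Fin d) → FreeGroup (Fin d) → ℝ) :
    ∑ a, ∑' x, h x (lt a * x) = ∑ a, ∑' x, h (lt a * x) x := by
  let e : (Fin d × Bool) ≃ (Fin d × Bool) := ⟨ia, ia, ia_ia, ia_ia⟩
  rw [← e.sum_comp]
  refine Finset.sum_congr rfl fun a _ => ?_
  rw [← (Equiv.mulLeft (lt a)).tsum_eq]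
  refine tsum_congr fun x => ?_
  change h (lt a * x) (lt (ia a) * (lt a * x)) = _
  rw [lt_ia_mul]


section sphere

/-- Sphere size. -/
noncomputable def S (d n : ℕ) : ℝ := ∑' x : FreeGroup (Fin d), if x.norm = n then (1 : ℝ) else 0

theorem summable_of_ball {f : FreeGroup (Fin d) → ℝ} (N : ℕ) (h : ∀ x, N < x.norm → f x = 0) :
    Summable f := by
  refine summable_of_hasFiniteSupport ((ball_finite N).subset fun x hx => ?_)
  by_contra hc
  exact hx (h x (by simpa using hc))

theorem S_zero : S d 0 = 1 := by
  unfold S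
  rw [tsum_eq_single 1]
  · simp
  · intro x hx; simp [FreeGroup.norm_eq_zero, hx]

theorem S_rec (n : ℕ) : ∑ a : Fin d × Bool, ∑' x : FreeGroup (Fin d),
    (if x.norm = n then (1:ℝ) else 0) * (if (lt a * x).norm = n + 1 then (1 : ℝ) else 0) = S d (n+1) := by
  rw [sa (fun x y => (if x.norm = n then (1:ℝ) else 0) * (if y.norm = n + 1 then (1 : ℝ) else 0))]
  rw [← Summable.tsum_finsetSum]
  · unfold S
    refine tsum_congr fun x => ?_
    rw [← Finset.sum_mul]
    by_cases hx : x.norm = n + 1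
    · have h1 : x ≠ 1 := by rintro rfl; simp at hx
      rw [nbr h1 (fun m => if m = n then (1:ℝ) else 0)]
      have : ¬ (n + 1 + 1 = n) := by omega
      simp [hx, this]
    · simp [hx]
  · intro a _
    refine summable_of_ball (n + 1) fun x hx => ?_
    rw [if_neg (c := x.norm = n + 1) (by omega), mul_zero]

theorem S_one : S d 1 = 2 * d := by
  rw [← S_rec, ← Summable.tsum_finsetSum]
  · rw [tsum_eq_single 1]
    · simp only [← Finset.mul_sum]
      rw [nbr_one (fun m => if m = 0 + 1 then (1:ℝ) else 0)]
      simp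
    · intro x hx; simp [FreeGroup.norm_eq_zero, hx]
  · intro a _
    refine summable_of_ball 0 fun x hx => ?_
    rw [if_neg (c := x.norm = 0) (by omega), zero_mul]

theorem S_succ (n : ℕ) : S d (n + 2) = (2 * d - 1) * S d (n + 1) := by
  rw [← S_rec, ← Summable.tsum_finsetSum]
  · unfold S
    rw [← tsum_mul_left]
    refine tsum_congr fun x => ?_
    rw [← Finset.mul_sum]
    by_cases hx : x.norm = n + 1
    · have h1 : x ≠ 1 := by rintro rfl; simp at hx
      rw [nbr h1 (fun m => if m = n + 1 + 1 then (1:ℝ) else 0)]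
      have : ¬ (n = n + 1 + 1) := by omega
      simp [hx, this]
    · simp [hx]
  · intro a _
    refine summable_of_ball (n + 1) fun x hx => ?_
    rw [if_neg (c := x.norm = n + 1) (by omega), zero_mul]

theorem S_succ_eq (n : ℕ) : S d (n + 1) = 2 * d * (2 * d - 1) ^ n := by
  induction n with
  | zero => simp [S_one]
  | succ n ih => rw [S_succ, ih]; ring

theorem S_bounds (hd : 2 ≤ d) {p : ℝ} (hp : (2 * d - 1) * p ^ 2 = 1) (n : ℕ) :
    1 ≤ S d n * (p ^ 2) ^ n ∧ S d n * (p ^ 2) ^ n ≤ 2 := by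
  have hd' : (2 : ℝ) ≤ d := by exact_mod_cast hd
  cases n with
  | zero => simp [S_zero]
  | succ n =>
    have : S d (n + 1) * (p ^ 2) ^ (n + 1) = 1 + p ^ 2 := by
      rw [S_succ_eq, pow_succ]
      have h2 : (2 * (d : ℝ) - 1) ^ n * (p ^ 2) ^ n = 1 := by rw [← mul_pow, hp, one_pow]
      linear_combination 2 * (d : ℝ) * p ^ 2 * h2 + hp
    rw [this]
    constructor <;> nlinarith [sq_nonneg p]

/-- The test function. -/
noncomputable def phi (p : ℝ) (N : ℕ) (n : ℕ) : ℝ := if n ≤ N then p ^ n else 0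

theorem phi_norm_eq (p : ℝ) (N : ℕ) : ∑' x : FreeGroup (Fin d), phi p N x.norm ^ 2 =
    ∑ n ∈ Finset.range (N + 1), S d n * (p ^ 2) ^ n := by
  unfold S
  simp only [← tsum_mul_right]
  rw [← Summable.tsum_finsetSum]
  · refine tsum_congr fun x => ?_
    simp only [ite_mul, one_mul, zero_mul, phi]
    rw [Finset.sum_ite_eq]
    simp only [Finset.mem_range, Nat.lt_succ_iff]
    split_ifs
    · ring
    · simp
  · intro n _
    refine summable_of_ball n fun x hx => ?_
    rw [if_neg (by omega), zero_mul]

theorem phi_norm_ge (hd : 2 ≤ d) {p : ℝ} (hp : (2 * d - 1) * p ^ 2 = 1) (N : ℕ) :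
    (N : ℝ) + 1 ≤ ∑' x : FreeGroup (Fin d), phi p N x.norm ^ 2 := by
  rw [phi_norm_eq]
  have := Finset.sum_le_sum (s := Finset.range (N + 1)) fun n _ => (S_bounds hd hp n).1
  simpa using this

theorem phi_norm_le (hd : 2 ≤ d) {p : ℝ} (hp : (2 * d - 1) * p ^ 2 = 1) (N : ℕ) :
    ∑' x : FreeGroup (Fin d), phi p N x.norm ^ 2 ≤ 2 * ((N : ℝ) + 1) := by
  rw [phi_norm_eq]
  have := Finset.sum_le_sum (s := Finset.range (N + 1)) fun n _ => (S_bounds hd hp n).2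
  refine this.trans (le_of_eq ?_)
  simp; ring

theorem phi_summable (p : ℝ) (N : ℕ) : Summable fun x : FreeGroup (Fin d) => phi p N x.norm ^ 2 :=
  summable_of_ball N fun x hx => by simp [phi, not_le.2 hx]

/-- `⟨Aφ,φ⟩ ≥ (2/p)‖φ‖² - 4/p`. -/
theorem phi_A (hd : 2 ≤ d) {p : ℝ} (hp0 : 0 < p) (hp : (2 * d - 1) * p ^ 2 = 1) (N : ℕ) :
    2 / p * ∑' x : FreeGroup (Fin d), phi p N x.norm ^ 2 - 4 / p ≤
      ∑' x : FreeGroup (Fin d), phi p N x.norm * ∑ a, phi p N (lt a * x).norm := by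
  have hphi : ∀ n, 0 ≤ phi p N n := fun n => by unfold phi; split_ifs <;> positivity
  have hd' : (2 : ℝ) ≤ d := by exact_mod_cast hd
  have key : ∀ x : FreeGroup (Fin d), 2 / p * phi p N x.norm ^ 2
      ≤ phi p N x.norm * ∑ a, phi p N (lt a * x).norm +
        (2 / p * (if x.norm = 0 then 1 else 0) + 1 / p * ((if x.norm = N then 1 else 0) * (p^2)^N)) := by
    intro x
    have hA0 : 0 ≤ ∑ a, phi p N (lt a * x).norm := Finset.sum_nonneg fun a _ => hphi _
    by_cases hx : x = 1
    · subst hx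
      have h1 : phi p N (FreeGroup.norm (1 : FreeGroup (Fin d))) = 1 := by simp [phi]
      rw [h1]
      have : 0 ≤ 1 / p * ((if FreeGroup.norm (1 : FreeGroup (Fin d)) = N then 1 else 0) * (p^2)^N) := by
        split_ifs <;> positivity
      simp only [FreeGroup.norm_one, if_true] at *
      linarith
    · have hn : x.norm ≠ 0 := fun h => hx (FreeGroup.norm_eq_zero.1 h)
      rw [nbr hx (phi p N)]
      obtain ⟨m, hm⟩ : ∃ m, x.norm = m + 1 := ⟨x.norm - 1, by omega⟩
      rw [hm]
      rw [if_neg (by omega)]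
      have hq : (2 * (d : ℝ) - 1) = 1 / p ^ 2 := by field_simp; linarith
      rw [hq]
      rcases lt_trichotomy (m + 1) N with h | h | h
      · rw [if_neg (by omega)]
        simp only [phi, if_pos (show m + 1 ≤ N by omega), if_pos (show m + 1 + 1 ≤ N by omega),
          if_pos (show m ≤ N by omega), Nat.add_sub_cancel]
        apply le_of_eq
        field_simp
        ring
      · subst h
        simp only [phi, if_pos (show m + 1 ≤ m + 1 by omega), if_neg (show ¬ (m + 1 + 1 ≤ m + 1) by omega),
          if_pos (show m ≤ m + 1 by omega), Nat.add_sub_cancel]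
        apply le_of_eq
        simp only [if_true]
        field_simp
        ring
      · rw [if_neg (by omega)]
        have : phi p N (m + 1) = 0 := if_neg (by omega)
        simp [this]
  have s1 : Summable fun x : FreeGroup (Fin d) => phi p N x.norm * ∑ a, phi p N (lt a * x).norm :=
    summable_of_ball N fun x hx => by simp [phi, not_le.2 hx]
  have s2 : ∀ n, Summable fun x : FreeGroup (Fin d) => if x.norm = n then (1 : ℝ) else 0 := fun n =>
    summable_of_ball n fun x hx => by rw [if_neg (by omega)]
  have s3 : Summable fun x : FreeGroup (Fin d) => 2 / p * (if x.norm = 0 then (1:ℝ) else 0) :=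
    (s2 0).mul_left _
  have s4 : Summable fun x : FreeGroup (Fin d) => 1 / p * ((if x.norm = N then (1:ℝ) else 0) * (p^2)^N) :=
    ((s2 N).mul_right _).mul_left _
  have := Summable.tsum_le_tsum key ((phi_summable p N).mul_left _) (s1.add (s3.add s4))
  rw [Summable.tsum_add s1 (s3.add s4), Summable.tsum_add s3 s4, tsum_mul_left, tsum_mul_left,
    tsum_mul_left, tsum_mul_right] at this
  change _ ≤ _ + (2 / p * S d 0 + 1 / p * (S d N * _)) at this
  rw [S_zero] at this
  have h2 := (S_bounds hd hp N).2
  have h3 : 1 / p * (S d N * (p^2)^N) ≤ 1 / p * 2 := mul_le_mul_of_nonneg_left h2 (by positivity)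
  have : 2 / p * 1 + 1 / p * 2 = 4 / p := by ring
  linarith

end sphere


section energy

/-- Weighted Dirichlet energy. -/
noncomputable def D (u ψ : FreeGroup (Fin d) → ℝ) : ℝ :=
  ∑ a, ∑' x, u x * u (lt a * x) * (ψ x - ψ (lt a * x)) ^ 2

theorem fs_shift {ψ : FreeGroup (Fin d) → ℝ} (h : ψ.support.Finite) (g : FreeGroup (Fin d)) :
    (fun x => ψ (g * x)).support.Finite :=
  h.preimage (mul_right_injective g).injOn

theorem fs_summable_diff {ψ : FreeGroup (Fin d) → ℝ} (h : ψ.support.Finite) (g : FreeGroup (Fin d))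
    (w : FreeGroup (Fin d) → ℝ) : Summable fun x => w x * (ψ x - ψ (g * x)) ^ 2 := by
  refine summable_of_hasFiniteSupport ((h.union (fs_shift h g)).subset fun x hx => ?_)
  by_contra hc
  simp only [Set.mem_union, Function.mem_support, not_or, not_not] at hc
  apply hx
  simp [hc.1, hc.2]

theorem D_term_le {u ψ : FreeGroup (Fin d) → ℝ} (hu : ∀ x, 0 < u x) (a : Fin d × Bool) :
    ∑' x, u x * u (lt a * x) * (ψ x - ψ (lt a * x)) ^ 2 ≤ D u ψ := by
  unfold D
  refine Finset.single_le_sum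
    (f := fun a => ∑' x, u x * u (lt a * x) * (ψ x - ψ (lt a * x)) ^ 2) (fun b _ => ?_) (Finset.mem_univ a)
  exact tsum_nonneg fun x => mul_nonneg (mul_nonneg (hu _).le (hu _).le) (sq_nonneg _)

theorem chain {q : ℝ} (hq : 0 ≤ q) (L : List (Fin d × Bool)) :
    ∃ C Q : ℝ, 0 ≤ C ∧ 0 ≤ Q ∧ ∀ u ψ : FreeGroup (Fin d) → ℝ, (∀ x, 0 < u x) →
      (∀ a x, u (lt a * x) ≤ q * u x) → ψ.support.Finite →
      (∀ x, u x ≤ Q * u (FreeGroup.mk L * x)) ∧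
      ∑' x, u x ^ 2 * (ψ x - ψ (FreeGroup.mk L * x)) ^ 2 ≤ C * D u ψ := by
  induction L with
  | nil =>
    refine ⟨0, 1, le_rfl, zero_le_one, fun u ψ _ _ _ => ⟨fun x => ?_, ?_⟩⟩
    · rw [← FreeGroup.one_eq_mk]; simp
    · rw [← FreeGroup.one_eq_mk]; simp
  | cons a L ih =>
    obtain ⟨C, Q, hC, hQ, ih⟩ := ih
    have hmk : FreeGroup.mk (a :: L) = lt a * FreeGroup.mk L := by simp [lt, FreeGroup.mul_mk]
    refine ⟨2 * C + 2 * Q ^ 2 * q, Q * q, by positivity, by positivity, fun u ψ hu hh hf => ?_⟩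
    obtain ⟨i1, i2⟩ := ih u ψ hu hh hf
    have hh' : ∀ a x, u x ≤ q * u (lt a * x) := fun a x => by
      have := hh (ia a) (lt a * x)
      rwa [lt_ia_mul] at this
    set g := FreeGroup.mk L
    rw [hmk]
    constructor
    · intro x
      calc u x ≤ Q * u (g * x) := i1 x
        _ ≤ Q * (q * u (lt a * (g * x))) := mul_le_mul_of_nonneg_left (hh' _ _) hQ
        _ = _ := by rw [mul_assoc, mul_assoc]
    · have key : ∀ x, u x ^ 2 * (ψ x - ψ (lt a * g * x)) ^ 2 ≤
          2 * (u x ^ 2 * (ψ x - ψ (g * x)) ^ 2) +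
          2 * Q ^ 2 * q * (u (g * x) * u (lt a * (g * x)) * (ψ (g * x) - ψ (lt a * (g * x))) ^ 2) := by
        intro x
        rw [mul_assoc]
        have h1 : u x ^ 2 ≤ Q ^ 2 * (q * (u (g * x) * u (lt a * (g * x)))) := by
          calc u x ^ 2 ≤ (Q * u (g * x)) ^ 2 := pow_le_pow_left₀ (hu _).le (i1 x) 2
            _ = Q ^ 2 * (u (g * x) * u (g * x)) := by ring
            _ ≤ Q ^ 2 * (u (g * x) * (q * u (lt a * (g * x)))) := by
              have := (hu (g * x)).le
              have := hh' a (g * x)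
              gcongr
            _ = _ := by ring
        have h2 : (ψ x - ψ (lt a * (g * x))) ^ 2 ≤
            2 * (ψ x - ψ (g * x)) ^ 2 + 2 * (ψ (g * x) - ψ (lt a * (g * x))) ^ 2 := by
          nlinarith [sq_nonneg ((ψ x - ψ (g * x)) - (ψ (g * x) - ψ (lt a * (g * x))))]
        have h3 := mul_le_mul_of_nonneg_left h2 (sq_nonneg (u x))
        have h4 := mul_le_mul_of_nonneg_right h1 (sq_nonneg (ψ (g * x) - ψ (lt a * (g * x))))
        nlinarith
      have sB := fs_summable_diff hf (lt a) (fun x => u x * u (lt a * x))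
      have sB' : Summable fun x => u (g * x) * u (lt a * (g * x)) * (ψ (g * x) - ψ (lt a * (g * x))) ^ 2 :=
        (Equiv.mulLeft g).summable_iff.2 sB
      have eB : ∑' x, u (g * x) * u (lt a * (g * x)) * (ψ (g * x) - ψ (lt a * (g * x))) ^ 2 =
          ∑' x, u x * u (lt a * x) * (ψ x - ψ (lt a * x)) ^ 2 :=
        (Equiv.mulLeft g).tsum_eq (fun x => u x * u (lt a * x) * (ψ x - ψ (lt a * x)) ^ 2)
      have sA := fs_summable_diff hf g (fun x => u x ^ 2)
      have := Summable.tsum_le_tsum key (fs_summable_diff hf (lt a * g) (fun x => u x ^ 2))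
        ((sA.mul_left 2).add (sB'.mul_left (2 * Q ^ 2 * q)))
      rw [Summable.tsum_add (sA.mul_left 2) (sB'.mul_left (2 * Q ^ 2 * q)), tsum_mul_left,
        tsum_mul_left, eB] at this
      have h5 := mul_le_mul_of_nonneg_left (D_term_le (ψ := ψ) hu a) (show 0 ≤ 2 * Q ^ 2 * q by positivity)
      nlinarith

theorem energy {u φ : FreeGroup (Fin d) → ℝ} (hu : ∀ x, 0 < u x) (hf : φ.support.Finite) :
    D u (fun x => φ x / u x) = 2 * ∑' x, φ x ^ 2 * ((∑ a, u (lt a * x)) / u x) -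
      2 * ∑' x, φ x * ∑ a, φ (lt a * x) := by
  have sm : ∀ w : FreeGroup (Fin d) → ℝ, Summable fun x => φ x ^ 2 * w x := fun w => by
    refine summable_of_hasFiniteSupport (hf.subset fun x hx => ?_)
    intro hc; apply hx; simp [hc]
  have sm2 : ∀ w : FreeGroup (Fin d) → ℝ, Summable fun x => φ x * w x := fun w => by
    refine summable_of_hasFiniteSupport (hf.subset fun x hx => ?_)
    intro hc; apply hx; simp [hc]
  have sm3 : ∀ a, Summable fun x => φ (lt a * x) ^ 2 * (u x / u (lt a * x)) := fun a => by
    refine summable_of_hasFiniteSupport ((fs_shift hf (lt a)).subset fun x hx => ?_)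
    intro hc; apply hx; simp [hc]
  unfold D
  have e1 : ∀ a, ∑' x, u x * u (lt a * x) * (φ x / u x - φ (lt a * x) / u (lt a * x)) ^ 2 =
      ∑' x, φ x ^ 2 * (u (lt a * x) / u x) + ∑' x, φ (lt a * x) ^ 2 * (u x / u (lt a * x))
        - 2 * ∑' x, φ x * φ (lt a * x) := by
    intro a
    rw [← Summable.tsum_add (sm _) (sm3 a), ← tsum_mul_left, ← Summable.tsum_sub ((sm _).add (sm3 a))
      ((sm2 _).mul_left 2)]
    refine tsum_congr fun x => ?_
    have h1 := (hu x).ne'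
    have h2 := (hu (lt a * x)).ne'
    field_simp
    ring
  simp only [e1]
  rw [Finset.sum_sub_distrib, Finset.sum_add_distrib, ← sa (fun x y => φ x ^ 2 * (u y / u x)),
    ← Finset.mul_sum, ← Summable.tsum_finsetSum (fun a _ => sm _),
    ← Summable.tsum_finsetSum (fun a _ => sm2 _)]
  simp only [← Finset.mul_sum, Finset.sum_div]
  ring

end energy


section poincare

theorem growth_le (hd : 2 ≤ d) (Δ : Subgroup (FreeGroup (Fin d))) (R : ℕ) (hR : 0 < R) :
    (growthCount Δ R : ℝ) ≤ (4 * (2 * d - 1)) ^ R := by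
  have hd' : (2 : ℝ) ≤ d := by exact_mod_cast hd
  have hq : (0 : ℝ) < 2 * d - 1 := by linarith
  set p : ℝ := Real.sqrt (2 * d - 1)⁻¹ with hpdef
  have hp2 : p ^ 2 = (2 * (d : ℝ) - 1)⁻¹ := Real.sq_sqrt (by positivity)
  have hp : (2 * (d : ℝ) - 1) * p ^ 2 = 1 := by rw [hp2]; field_simp
  have hfin := ball_finite (d := d) R
  have h1 : (growthCount Δ R : ℝ) ≤ hfin.toFinset.card := by
    rw [growthCount]
    have : Nat.card {g : FreeGroup (Fin d) // g ∈ Δ ∧ FreeGroup.norm g ≤ R} ≤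
        Nat.card {g : FreeGroup (Fin d) | FreeGroup.norm g ≤ R} := by
      have := hfin.to_subtype
      exact Nat.card_le_card_of_injective (fun g => ⟨g.1, g.2.2⟩) fun a b h => by
        simpa [Subtype.ext_iff] using h
    rw [Nat.card_coe_set_eq, Set.ncard_eq_toFinset_card _ hfin] at this
    exact_mod_cast this
  have h2 : (hfin.toFinset.card : ℝ) * (p ^ 2) ^ R ≤ ∑' x : FreeGroup (Fin d), phi p R x.norm ^ 2 := by
    refine le_trans ?_ ((phi_summable p R).sum_le_tsum hfin.toFinset fun x _ => sq_nonneg _)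
    rw [← nsmul_eq_mul]
    refine Finset.card_nsmul_le_sum _ _ _ fun x hx => ?_
    have hx : x.norm ≤ R := by simpa using hx
    rw [phi, if_pos hx, ← pow_mul, mul_comm, pow_mul]
    rw [← pow_mul, ← pow_mul, mul_comm R, mul_comm x.norm, pow_mul, pow_mul]
    refine pow_le_pow_of_le_one (sq_nonneg _) ?_ hx
    rw [hp2]; exact inv_le_one_of_one_le₀ (by linarith)
  have h3 := h2.trans (phi_norm_le hd hp R)
  have h4 : 1 + (R : ℝ) * 3 ≤ (1 + 3) ^ R := one_add_mul_le_pow (by norm_num) R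
  have hR' : (1 : ℝ) ≤ R := by exact_mod_cast hR
  have h5 : (2 * (d : ℝ) - 1) ^ R * (p ^ 2) ^ R = 1 := by rw [← mul_pow, hp, one_pow]
  have h6 : 0 < (2 * (d : ℝ) - 1) ^ R := by positivity
  calc (growthCount Δ R : ℝ) ≤ hfin.toFinset.card := h1
    _ = (2 * (d : ℝ) - 1) ^ R * (hfin.toFinset.card * (p ^ 2) ^ R) := by
      linear_combination (-(hfin.toFinset.card : ℝ)) * h5
    _ ≤ (2 * (d : ℝ) - 1) ^ R * 4 ^ R := by
      refine mul_le_mul_of_nonneg_left (h3.trans ?_) h6.le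
      norm_num at h4
      linarith
    _ = _ := by rw [mul_pow, mul_comm]

theorem summable_orbit (hd : 2 ≤ d) (Δ : Subgroup (FreeGroup (Fin d)))
    (hδ : critExp Δ ≤ Real.log (2 * (d : ℝ) - 1) / 2) {r : ℝ} (hr0 : 0 < r)
    (hr : Real.log r < - (Real.log (2 * (d : ℝ) - 1) / 2)) :
    Summable fun γ : Δ => r ^ (γ : FreeGroup (Fin d)).norm := by
  have hd' : (2 : ℝ) ≤ d := by exact_mod_cast hd
  obtain ⟨s, hs1, hs2⟩ := exists_between (show Real.log (2 * (d : ℝ) - 1) / 2 < - Real.log r by linarith)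
  have hpos : ∀ R, 0 < growthCount Δ R := fun R => by
    have : Finite {g : FreeGroup (Fin d) // g ∈ Δ ∧ FreeGroup.norm g ≤ R} :=
      ((ball_finite (d := d) R).subset (t := {g | g ∈ Δ ∧ g.norm ≤ R}) fun g hg => hg.2).to_subtype
    have : Nonempty {g : FreeGroup (Fin d) // g ∈ Δ ∧ FreeGroup.norm g ≤ R} :=
      ⟨1, Δ.one_mem, by simp⟩
    exact Nat.card_pos
  have hbdd : IsBoundedUnder (· ≤ ·) atTop fun R : ℕ => Real.log (growthCount Δ R : ℝ) / (R : ℝ) := by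
    refine isBoundedUnder_of_eventually_le (a := Real.log (4 * (2 * d - 1))) ?_
    filter_upwards [eventually_gt_atTop 0] with R hR
    rw [div_le_iff₀ (by exact_mod_cast hR), mul_comm, ← Real.log_pow]
    exact Real.log_le_log (by exact_mod_cast hpos R) (growth_le hd Δ R hR)
  have hev := eventually_lt_of_limsup_lt (hδ.trans_lt hs1) hbdd
  have hsum : Summable fun R : ℕ => (growthCount Δ R : ℝ) * r ^ R := by
    have hg : Summable fun R : ℕ => (Real.exp s * r) ^ R := by
      refine summable_geometric_of_lt_one (by positivity) ?_
      rw [← Real.exp_log hr0, ← Real.exp_add, Real.exp_lt_one_iff]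
      linarith
    refine hg.of_norm_bounded_eventually_nat ?_
    filter_upwards [hev, eventually_gt_atTop 0] with R hR hR0
    rw [Real.norm_of_nonneg (by positivity), mul_pow]
    refine mul_le_mul_of_nonneg_right ?_ (by positivity)
    rw [div_lt_iff₀ (by exact_mod_cast hR0)] at hR
    rw [← Real.exp_nat_mul, mul_comm, ← Real.log_le_iff_le_exp (by exact_mod_cast hpos R)]
    exact hR.le
  refine summable_of_sum_le (c := ∑' R : ℕ, (growthCount Δ R : ℝ) * r ^ R) (fun γ => by positivity) ?_
  intro T
  classical
  rw [← Finset.sum_fiberwise_of_maps_to (t := T.image fun γ : Δ => (γ : FreeGroup (Fin d)).norm)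
    (g := fun γ : Δ => (γ : FreeGroup (Fin d)).norm) (fun x hx => Finset.mem_image_of_mem _ hx)]
  refine le_trans (Finset.sum_le_sum (g := fun R : ℕ => (growthCount Δ R : ℝ) * r ^ R) fun R _ => ?_)
    (hsum.sum_le_tsum _ fun R _ => by positivity)
  rw [Finset.sum_congr rfl (g := fun _ => r ^ R)]
  · rw [Finset.sum_const, nsmul_eq_mul]
    refine mul_le_mul_of_nonneg_right ?_ (by positivity)
    have : Finite {g : FreeGroup (Fin d) // g ∈ Δ ∧ FreeGroup.norm g ≤ R} :=
      ((ball_finite (d := d) R).subset (t := {g | g ∈ Δ ∧ g.norm ≤ R}) fun g hg => hg.2).to_subtype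
    rw [growthCount, Nat.cast_le, ← Nat.card_eq_finsetCard]
    refine Nat.card_le_card_of_injective
      (β := {g : FreeGroup (Fin d) // g ∈ Δ ∧ FreeGroup.norm g ≤ R})
      (fun γ => ⟨γ.1.1, γ.1.2, (Finset.mem_filter.1 γ.2).2.le⟩) fun a b h => ?_
    have h2 : (a.1.1 : FreeGroup (Fin d)) = b.1.1 := (Subtype.mk.injEq _ _ _ _).mp h
    exact Subtype.ext (Subtype.ext h2)
  · intro γ hγ
    rw [(Finset.mem_filter.1 hγ).2]

/-- Poincaré series. -/
noncomputable def U (Δ : Subgroup (FreeGroup (Fin d))) (r : ℝ) (x : FreeGroup (Fin d)) : ℝ :=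
  ∑' γ : Δ, r ^ (x * (γ : FreeGroup (Fin d))).norm

variable {Δ : Subgroup (FreeGroup (Fin d))} {r : ℝ}

theorem U_summable (hr0 : 0 < r) (hr1 : r ≤ 1)
    (hs : Summable fun γ : Δ => r ^ (γ : FreeGroup (Fin d)).norm) (x : FreeGroup (Fin d)) :
    Summable fun γ : Δ => r ^ (x * (γ : FreeGroup (Fin d))).norm := by
  refine Summable.of_nonneg_of_le (fun γ => by positivity) (fun γ => ?_) (hs.mul_left (r ^ x.norm)⁻¹)
  rw [← div_eq_inv_mul, le_div_iff₀ (by positivity), ← pow_add]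
  refine pow_le_pow_of_le_one hr0.le hr1 ?_
  have := FreeGroup.norm_mul_le x⁻¹ (x * γ)
  rw [FreeGroup.norm_inv_eq, inv_mul_cancel_left] at this
  omega

theorem U_pos (hr0 : 0 < r) (hr1 : r ≤ 1)
    (hs : Summable fun γ : Δ => r ^ (γ : FreeGroup (Fin d)).norm) (x : FreeGroup (Fin d)) :
    0 < U Δ r x :=
  (U_summable hr0 hr1 hs x).tsum_pos (fun γ => by positivity) 1 (by positivity)

theorem U_inv (x : FreeGroup (Fin d)) (γ : Δ) : U Δ r (x * γ) = U Δ r x := by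
  unfold U
  rw [← (Equiv.mulLeft γ).tsum_eq (fun γ : Δ => r ^ (x * (γ : FreeGroup (Fin d))).norm)]
  simp [mul_assoc]

theorem U_harnack (hr0 : 0 < r) (hr1 : r ≤ 1)
    (hs : Summable fun γ : Δ => r ^ (γ : FreeGroup (Fin d)).norm) (a : Fin d × Bool)
    (x : FreeGroup (Fin d)) : U Δ r (lt a * x) ≤ r⁻¹ * U Δ r x := by
  unfold U
  rw [← tsum_mul_left]
  refine Summable.tsum_le_tsum (fun γ => ?_) (U_summable hr0 hr1 hs _)
    ((U_summable hr0 hr1 hs _).mul_left _)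
  rw [← div_eq_inv_mul, le_div_iff₀ hr0, ← pow_succ, mul_assoc]
  exact pow_le_pow_of_le_one hr0.le hr1 (norm_le_lt_mul _ _)

theorem A_pow (hr0 : 0 < r) (hr1 : r ≤ 1) (x : FreeGroup (Fin d)) :
    ∑ a, r ^ (lt a * x).norm ≤ ((2 * (d : ℝ) - 1) * r + 1 / r) * r ^ x.norm := by
  by_cases hx : x = 1
  · subst hx
    rw [nbr_one (fun n => r ^ n)]
    have : r ≤ 1 / r := by rw [le_div_iff₀ hr0]; nlinarith
    simp only [FreeGroup.norm_one, pow_zero, pow_one]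
    linarith
  · rw [nbr hx (fun n => r ^ n)]
    have hn : x.norm ≠ 0 := fun h => hx (FreeGroup.norm_eq_zero.1 h)
    obtain ⟨m, hm⟩ : ∃ m, x.norm = m + 1 := ⟨x.norm - 1, by omega⟩
    rw [hm, Nat.add_sub_cancel]
    apply le_of_eq
    field_simp
    ring

theorem U_super (hr0 : 0 < r) (hr1 : r ≤ 1)
    (hs : Summable fun γ : Δ => r ^ (γ : FreeGroup (Fin d)).norm) (x : FreeGroup (Fin d)) :
    ∑ a, U Δ r (lt a * x) ≤ ((2 * (d : ℝ) - 1) * r + 1 / r) * U Δ r x := by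
  unfold U
  rw [← tsum_mul_left, ← Summable.tsum_finsetSum (fun a _ => U_summable hr0 hr1 hs _)]
  refine Summable.tsum_le_tsum (fun γ => ?_) (summable_sum fun a _ => U_summable hr0 hr1 hs _)
    ((U_summable hr0 hr1 hs _).mul_left _)
  simp only [mul_assoc (lt _) x]
  exact A_pow hr0 hr1 _

end poincare

theorem phi_diff {p : ℝ} (hp0 : 0 < p) (hp1 : p < 1) (N : ℕ) {m n : ℕ} (h : n ≠ m) :
    (1 - p) ^ 2 * phi p N m ^ 2 ≤ (phi p N m - phi p N n) ^ 2 := by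
  unfold phi
  by_cases hm : m ≤ N
  · rw [if_pos hm, ← mul_pow]
    have hpm : 0 < p ^ m := by positivity
    rcases lt_or_gt_of_ne h with h | h
    · rw [if_pos (by omega), ← neg_sq (p ^ m - p ^ n)]
      refine pow_le_pow_left₀ (by nlinarith) ?_ 2
      have h1 : p ^ m ≤ p ^ (n + 1) := pow_le_pow_of_le_one hp0.le hp1.le h
      have h2 : 0 < p ^ n := by positivity
      have h3 : p ^ m ≤ p ^ n := pow_le_pow_of_le_one hp0.le hp1.le h.le
      rw [pow_succ] at h1
      nlinarith
    · refine pow_le_pow_left₀ (by nlinarith) ?_ 2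
      have h1 : p ^ n ≤ p ^ (m + 1) := pow_le_pow_of_le_one hp0.le hp1.le h
      rw [pow_succ] at h1
      split_ifs <;> nlinarith
  · rw [if_neg hm]
    simp; positivity

theorem main (hd : 2 ≤ d) (Δ : Subgroup (FreeGroup (Fin d)))
    (hδ : critExp Δ ≤ Real.log (2 * (d : ℝ) - 1) / 2) (n : ℕ)
    (hconf : ∀ x : FreeGroup (Fin d), ∃ k : FreeGroup (Fin d), k ≠ 1 ∧ k.norm ≤ n ∧ x⁻¹ * k * x ∈ Δ) :
    False := by
  have hd' : (2 : ℝ) ≤ d := by exact_mod_cast hd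
  set q : ℝ := 2 * d - 1 with hqdef
  have hq : 3 ≤ q := by linarith
  set p : ℝ := Real.sqrt q⁻¹ with hpdef
  have hp2 : p ^ 2 = q⁻¹ := Real.sq_sqrt (by positivity)
  have hp : q * p ^ 2 = 1 := by rw [hp2]; field_simp
  have hp0 : 0 < p := Real.sqrt_pos.2 (by positivity)
  have hp1 : p < 1 := by nlinarith
  have hqp : q⁻¹ < p := by rw [← hp2]; nlinarith
  have hlogp : Real.log p = - (Real.log q / 2) := by
    rw [hpdef, Real.log_sqrt (by positivity), Real.log_inv]; ring
  -- the set of deck elements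
  have hfin := ball_finite (d := d) (2 * n)
  set K := hfin.toFinset with hK
  have hconf2 : ∀ x : FreeGroup (Fin d), ∃ k ∈ K, x⁻¹ * k * x ∈ Δ ∧ (k * x).norm ≠ x.norm := by
    intro x
    obtain ⟨k, h1, h2, h3⟩ := hconf x
    rcases norm_ne h1 x with h | h
    · exact ⟨k, by simp [hK]; omega, h3, h⟩
    · refine ⟨k * k, ?_, ?_, h⟩
      · have := FreeGroup.norm_mul_le k k
        simp [hK]; omega
      · have := Δ.mul_mem h3 h3
        convert this using 1
        group
  choose C Q hC hQ hCQ using fun k : FreeGroup (Fin d) => chain (d := d) (q := q) (by linarith) k.toWord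
  set M := ∑ k ∈ K, C k with hM
  have hM0 : 0 ≤ M := Finset.sum_nonneg fun k _ => hC k
  have hW : 0 < (1 - p) ^ 2 := pow_pos (by linarith) 2
  obtain ⟨N, hN⟩ := exists_nat_gt (M * (2 + 8 / p) / (1 - p) ^ 2)
  rw [div_lt_iff₀ hW] at hN
  set Z := ∑' x : FreeGroup (Fin d), phi p N x.norm ^ 2 with hZ
  have hZN : (N : ℝ) + 1 ≤ Z := phi_norm_ge hd hp N
  -- choose r
  obtain ⟨r, hr1, hr2, hr3⟩ : ∃ r, q⁻¹ < r ∧ r < p ∧ (q * r + 1 / r - 2 / p) * Z < 1 := by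
    have hc : Tendsto (fun r : ℝ => (q * r + 1 / r - 2 / p) * Z) (nhdsWithin p (Set.Iio p))
        (nhds ((q * p + 1 / p - 2 / p) * Z)) := by
      refine Tendsto.mono_left ?_ nhdsWithin_le_nhds
      have : ContinuousAt (fun r : ℝ => (q * r + 1 / r - 2 / p) * Z) p := by
        have := hp0.ne'
        fun_prop (disch := assumption)
      exact this
    have h0 : (q * p + 1 / p - 2 / p) * Z = 0 := by
      have : q * p + 1 / p - 2 / p = 0 := by
        field_simp; linarith
      rw [this, zero_mul]
    rw [h0] at hc
    have e1 := hc.eventually (gt_mem_nhds zero_lt_one)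
    have e2 : ∀ᶠ r in nhdsWithin p (Set.Iio p), q⁻¹ < r := nhdsWithin_le_nhds (lt_mem_nhds hqp)
    have e3 : ∀ᶠ r in nhdsWithin p (Set.Iio p), r < p := eventually_mem_nhdsWithin
    obtain ⟨r, h1, h2, h3⟩ := (e1.and (e2.and e3)).exists
    exact ⟨r, h2, h3, h1⟩
  have hr0 : 0 < r := lt_trans (by positivity) hr1
  have hrle : r ≤ 1 := by linarith
  have hs : Summable fun γ : Δ => r ^ (γ : FreeGroup (Fin d)).norm :=
    summable_orbit hd Δ hδ hr0 (by rw [← hlogp]; exact Real.log_lt_log hr0 hr2)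
  set u := U Δ r with hu
  have upos : ∀ x, 0 < u x := U_pos hr0 hrle hs
  have uh : ∀ a x, u (lt a * x) ≤ q * u x := fun a x => by
    refine (U_harnack hr0 hrle hs a x).trans (mul_le_mul_of_nonneg_right ?_ (upos x).le)
    exact inv_le_of_inv_le₀ (by positivity) hr1.le
  set φ : FreeGroup (Fin d) → ℝ := fun x => phi p N x.norm with hφ
  have hφf : φ.support.Finite := (ball_finite N).subset fun x hx => by
    by_contra hc
    exact hx (if_neg hc)
  set ψ : FreeGroup (Fin d) → ℝ := fun x => φ x / u x with hψ
  have hψf : ψ.support.Finite := hφf.subset fun x hx => by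
    intro hc; apply hx; simp [hψ, hc]
  -- upper bound
  have hup : D u ψ ≤ 2 + 8 / p := by
    rw [energy upos hφf]
    have h1 := phi_A hd hp0 hp N
    have h2 : ∑' x, φ x ^ 2 * ((∑ a, u (lt a * x)) / u x) ≤ (q * r + 1 / r) * Z := by
      rw [hZ, ← tsum_mul_left]
      refine Summable.tsum_le_tsum (fun x => ?_) ?_ ((phi_summable p N).mul_left _)
      · rw [mul_comm]
        refine mul_le_mul_of_nonneg_right ?_ (sq_nonneg _)
        rw [div_le_iff₀ (upos x)]
        exact U_super hr0 hrle hs x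
      · exact summable_of_ball N fun x hx => by simp [hφ, phi, not_le.2 hx]
    have h4 : 8 / p = 2 * (4 / p) := by ring
    rw [← hZ] at h1
    change _ ≤ ∑' x, φ x * ∑ a, φ (lt a * x) at h1
    nlinarith
  -- lower bound
  have hlow : (1 - p) ^ 2 * Z ≤ M * D u ψ := by
    have sK : ∀ k ∈ K, Summable fun x => u x ^ 2 * (ψ x - ψ (k * x)) ^ 2 :=
      fun k _ => fs_summable_diff hψf k _
    have h1 : (1 - p) ^ 2 * Z ≤ ∑' x, ∑ k ∈ K, u x ^ 2 * (ψ x - ψ (k * x)) ^ 2 := by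
      rw [hZ, ← tsum_mul_left]
      refine Summable.tsum_le_tsum (fun x => ?_) ((phi_summable p N).mul_left _) (summable_sum sK)
      obtain ⟨k, hk, hkΔ, hkn⟩ := hconf2 x
      refine le_trans ?_ (Finset.single_le_sum (f := fun k => u x ^ 2 * (ψ x - ψ (k * x)) ^ 2)
        (fun k _ => by positivity) hk)
      have huk : u (k * x) = u x := by
        have := U_inv (r := r) x ⟨_, hkΔ⟩
        rw [← hu] at this
        rw [← this]
        congr 1
        simp only []
        group
      have : u x ^ 2 * (ψ x - ψ (k * x)) ^ 2 = (φ x - φ (k * x)) ^ 2 := by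
        simp only [hψ, huk]
        have := (upos x).ne'
        field_simp
      simp only [this]
      exact phi_diff hp0 hp1 N hkn
    rw [Summable.tsum_finsetSum sK] at h1
    refine h1.trans ?_
    rw [hM, Finset.sum_mul]
    refine Finset.sum_le_sum fun k _ => ?_
    have := (hCQ k u ψ upos uh hψf).2
    rwa [FreeGroup.mk_toWord] at this
  have h1 := mul_le_mul_of_nonneg_left hup hM0
  nlinarith

end NC

theorem nonconfined_of_small_critExp (d : ℕ) (hd : 2 ≤ d)
    (Δ : Subgroup (FreeGroup (Fin d)))
    (hδ : critExp Δ ≤ Real.log (2 * (d : ℝ) - 1) / 2) :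
    ∃ g : ℕ → FreeGroup (Fin d),
      ChabautyTendsto (fun n => Subgroup.map (MulAut.conj (g n)).toMonoidHom Δ) ⊥ := by
  have h : ∀ n : ℕ, ∃ g : FreeGroup (Fin d), ∀ k : FreeGroup (Fin d), k ≠ 1 → k.norm ≤ n →
      g⁻¹ * k * g ∉ Δ := by
    intro n
    by_contra! hc
    exact NC.main hd Δ hδ n hc
  choose g hg using h
  refine ⟨g, fun k => ?_⟩
  filter_upwards [eventually_ge_atTop k.norm] with n hn
  by_cases hk : k = 1
  · subst hk
    simp only [Subgroup.one_mem]
  · rw [Subgroup.mem_bot]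
    refine iff_of_false ?_ hk
    rintro ⟨γ, hγ, rfl⟩
    refine hg n _ hk hn ?_
    have : (g n)⁻¹ * (MulAut.conj (g n)).toMonoidHom γ * g n = γ := by
      simp [MulAut.conj_apply]
      group
    rw [this]
    exact hγ
end

section
/- Let d ≥ 2. The set of critical exponents of finitely generated subgroups of F_d, i.e. {δ(H) : H a finitely generated subgroup of F_d}, is dense in the interval [0, log(2d−1)]. -/
open Filter

namespace CritDense

open FreeGroup

variable {d : ℕ}

/-! ### Balls are finite, with a crude upper bound -/

lemma ball_inj (R : ℕ) : Function.Injective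
    (fun (w : {w : FreeGroup (Fin d) // norm w ≤ R}) (i : Fin R) => w.1.toWord[i.1]?) := by
  rintro ⟨w, hw⟩ ⟨v, hv⟩ h
  apply Subtype.ext
  apply FreeGroup.toWord_injective
  apply List.ext_getElem?
  intro i
  by_cases hi : i < R
  · exact congrFun h ⟨i, hi⟩
  · have h1 : w.toWord.length ≤ i := le_trans hw (not_lt.1 hi)
    have h2 : v.toWord.length ≤ i := le_trans hv (not_lt.1 hi)
    simp [h1, h2]

instance ball_finite (R : ℕ) : Finite {w : FreeGroup (Fin d) // norm w ≤ R} :=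
  Finite.of_injective _ (ball_inj R)

lemma ball_card_le (R : ℕ) :
    Nat.card {w : FreeGroup (Fin d) // norm w ≤ R} ≤ (2 * d + 1) ^ R := by
  refine (Nat.card_le_card_of_injective _ (ball_inj R)).trans ?_
  simp [Nat.card_eq_fintype_card, mul_comm]

/-! ### A finite quotient injective on a large ball -/

lemma exists_quotient (d g : ℕ) : ∃ (B : Type) (_ : Finite B)
    (π : FreeGroup (Fin d) →* Equiv.Perm B), ∀ w, FreeGroup.norm w ≤ g → π w = 1 → w = 1 := by
  classical
  let B := {w : FreeGroup (Fin d) // norm w ≤ g}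
  have key : ∀ j : Fin d, ∃ σ : Equiv.Perm B, ∀ (x y : B), y.1 = of j * x.1 → σ x = y := by
    intro j
    obtain ⟨σ, hσ⟩ := Equiv.Perm.exists_extending_pair
      (fun x : {x : B // norm (of j * x.1) ≤ g} => x.1)
      (fun x : {x : B // norm (of j * x.1) ≤ g} => (⟨of j * x.1.1, x.2⟩ : B))
      Subtype.val_injective
      (by
        rintro ⟨x, hx⟩ ⟨y, hy⟩ h
        have := congrArg Subtype.val h
        simp only [mul_right_inj] at this
        exact Subtype.ext (Subtype.ext this))
    refine ⟨σ, fun x y hxy => ?_⟩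
    have h1 : norm (of j * x.1) ≤ g := hxy ▸ y.2
    have := hσ ⟨x, h1⟩
    simp only at this
    rw [this]
    exact Subtype.ext hxy.symm
  choose σ hσ using key
  refine ⟨B, inferInstance, FreeGroup.lift σ, ?_⟩
  have main : ∀ (L : List (Fin d × Bool)) (h : L.length ≤ g),
      FreeGroup.lift σ (mk L) (⟨1, by simp⟩ : B) = ⟨mk L, norm_mk_le.trans h⟩ := by
    intro L
    induction L with
    | nil => intro h; simp [← one_eq_mk]
    | cons x L ih =>
      intro h
      have h' : L.length ≤ g := by simp at h; omega
      obtain ⟨j, b⟩ := x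
      have e : mk ((j, b) :: L) = mk [(j, b)] * mk L := by simp
      have : FreeGroup.lift σ (mk ((j, b) :: L)) (⟨1, by simp⟩ : B) =
          FreeGroup.lift σ (mk [(j, b)]) ⟨mk L, norm_mk_le.trans h'⟩ := by
        rw [e, _root_.map_mul, Equiv.Perm.mul_apply, ih h']
      rw [this]
      cases b
      · have e2 : mk [(j, false)] = (of j)⁻¹ := rfl
        rw [e2, _root_.map_inv, lift_apply_of, Equiv.Perm.inv_eq_iff_eq]
        symm
        apply hσ
        simp only [e, e2]
        group
      · have e2 : mk [(j, true)] = of j := rfl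
        rw [e2, lift_apply_of]
        apply hσ
        simp only [e, e2]
  intro w hw h
  have := main w.toWord hw
  simp only [mk_toWord, h] at this
  exact (congrArg Subtype.val this).symm

/-! ### Lower bound for balls -/

/-- Prefix letters to a word, each one avoiding the inverse of the previous letter. -/
def build {k : ℕ} (φ : Fin d × Bool → Fin k → Fin d × Bool) (y0 : Fin d × Bool) :
    List (Fin k) → List (Fin d × Bool)
  | [] => []
  | i :: l => φ ((build φ y0 l).headD y0) i :: build φ y0 l

lemma build_length {k : ℕ} (φ : Fin d × Bool → Fin k → Fin d × Bool) (y0 : Fin d × Bool)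
    (l : List (Fin k)) : (build φ y0 l).length = l.length := by
  induction l with
  | nil => rfl
  | cons i l ih => simp [build, ih]

lemma build_inj {k : ℕ} (φ : Fin d × Bool → Fin k → Fin d × Bool) (y0 : Fin d × Bool)
    (hφ : ∀ y, Function.Injective (φ y)) : Function.Injective (build φ y0) := by
  intro l
  induction l with
  | nil => intro l' h; cases l' <;> simp_all [build]
  | cons i l ih =>
    intro l' h
    cases l' with
    | nil => simp [build] at h
    | cons i' l' =>
      simp only [build, List.cons.injEq] at h
      obtain ⟨h1, h2⟩ := h
      have := ih h2
      subst this
      rw [hφ _ h1]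

lemma build_reduced {k : ℕ} (φ : Fin d × Bool → Fin k → Fin d × Bool) (y0 : Fin d × Bool)
    (hφ : ∀ y i, φ y i ≠ (y.1, !y.2)) (l : List (Fin k)) : IsReduced (build φ y0 l) := by
  induction l with
  | nil => exact IsReduced.nil
  | cons i l ih =>
    simp only [build]
    cases hb : build φ y0 l with
    | nil => exact IsReduced.singleton
    | cons y t =>
      rw [hb] at ih
      refine List.isChain_cons_cons.2 ⟨?_, ih⟩
      intro h1
      by_contra h2
      apply hφ y i
      simp only [List.headD_cons] at h1 h2
      refine Prod.ext h1 ?_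
      revert h2
      cases (φ y i).2 <;> cases y.2 <;> simp

lemma ball_card_ge (hd : 2 ≤ d) (R : ℕ) :
    (2 * d - 1) ^ R ≤ Nat.card {w : FreeGroup (Fin d) // norm w ≤ R} := by
  classical
  have hφ : ∀ y : Fin d × Bool, ∃ φ : Fin (2 * d - 1) → Fin d × Bool,
      Function.Injective φ ∧ ∀ i, φ i ≠ (y.1, !y.2) := by
    intro y
    have hc : Fintype.card {x : Fin d × Bool // x ≠ (y.1, !y.2)} = 2 * d - 1 := by
      rw [Fintype.card_subtype_compl]
      simp [mul_comm]
    let e := (Fintype.equivFinOfCardEq hc).symm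
    exact ⟨fun i => (e i).1, Subtype.val_injective.comp e.injective, fun i => (e i).2⟩
  choose φ hφ1 hφ2 using hφ
  let y0 : Fin d × Bool := (⟨0, by omega⟩, true)
  have hlen : ∀ f : Fin R → Fin (2 * d - 1), norm (mk (build φ y0 (List.ofFn f))) ≤ R := by
    intro f
    refine norm_mk_le.trans ?_
    simp [build_length]
  have : Function.Injective (fun f : Fin R → Fin (2 * d - 1) =>
      (⟨mk (build φ y0 (List.ofFn f)), hlen f⟩ : {w : FreeGroup (Fin d) // norm w ≤ R})) := by
    intro f f' h
    have h1 := congrArg (fun w => w.1.toWord) h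
    simp only [toWord_mk, (build_reduced φ y0 hφ2 _).reduce_eq] at h1
    exact List.ofFn_injective (build_inj φ y0 hφ1 h1)
  have := Nat.card_le_card_of_injective _ this
  simpa [Nat.card_eq_fintype_card] using this

/-! ### The stretched subgroups -/

section Stretch

variable {Q : Type} [Group Q] (π : FreeGroup (Fin d) →* Q) (m : Q × Fin d → ℕ)

/-- The (unoriented) edge of the Cayley graph crossed by the letter `x` from the vertex `s`. -/
def edge (x : Fin d × Bool) (s : Q) : Q × Fin d :=
  if x.2 then (s, x.1) else ((π (of x.1))⁻¹ * s, x.1)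

/-- The list of edges crossed by a word (read from right to left). -/
def edges : List (Fin d × Bool) → List (Q × Fin d)
  | [] => []
  | x :: L => edge π x (π (mk L)) :: edges L

/-- The stretched word. -/
def expand : List (Fin d × Bool) → List (Fin d × Bool)
  | [] => []
  | x :: L => List.replicate (m (edge π x (π (mk L)))) x ++ expand L

/-- The stretched length. -/
def len (w : FreeGroup (Fin d)) : ℕ := ((edges π w.toWord).map m).sum

lemma expand_length (L : List (Fin d × Bool)) :
    (expand π m L).length = ((edges π L).map m).sum := by
  induction L with
  | nil => rfl
  | cons x L ih => simp [expand, edges, ih]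

lemma edges_length (L : List (Fin d × Bool)) : (edges π L).length = L.length := by
  induction L with
  | nil => rfl
  | cons x L ih => simp [edges, ih]

lemma expand_head (hm : ∀ e, 1 ≤ m e) (L : List (Fin d × Bool)) :
    (expand π m L).head? = L.head? := by
  cases L with
  | nil => rfl
  | cons x L =>
    simp only [expand]
    obtain ⟨n, hn⟩ := Nat.exists_eq_add_of_le (hm (edge π x (π (mk L))))
    rw [hn, add_comm, List.replicate_succ]
    simp

lemma replicate_append_reduced (x : Fin d × Bool) (L : List (Fin d × Bool))
    (h : IsReduced (x :: L)) (n : ℕ) : IsReduced (List.replicate (n + 1) x ++ L) := by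
  induction n with
  | zero => simpa using h
  | succ n ih =>
    rw [List.replicate_succ, List.cons_append]
    rw [List.replicate_succ, List.cons_append] at ih ⊢
    exact List.isChain_cons_cons.2 ⟨fun _ => rfl, ih⟩

lemma expand_reduced (hm : ∀ e, 1 ≤ m e) (L : List (Fin d × Bool)) (h : IsReduced L) :
    IsReduced (expand π m L) := by
  induction L with
  | nil => exact IsReduced.nil
  | cons x L ih =>
    have hL : IsReduced L := h.infix (List.infix_cons (List.infix_refl _))
    simp only [expand]
    obtain ⟨n, hn⟩ := Nat.exists_eq_add_of_le (hm (edge π x (π (mk L))))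
    rw [hn, add_comm]
    apply replicate_append_reduced
    have h0 := expand_head π m hm L
    cases hE : expand π m L with
    | nil => exact IsReduced.singleton
    | cons y t =>
      cases L with
      | nil => simp [expand] at hE
      | cons z L' =>
        rw [hE] at h0
        simp only [List.head?_cons, Option.some.injEq] at h0
        subst h0
        have := ih hL
        rw [hE] at this
        exact List.isChain_cons_cons.2 ⟨(List.isChain_cons_cons.1 h).1, this⟩

/-- The permutation of `Q × F_d` attached to a generator. -/
def gen (j : Fin d) : Equiv.Perm (Q × FreeGroup (Fin d)) where
  toFun p := (π (of j) * p.1, of j ^ m (p.1, j) * p.2)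
  invFun p := ((π (of j))⁻¹ * p.1, (of j ^ m ((π (of j))⁻¹ * p.1, j))⁻¹ * p.2)
  left_inv p := by simp
  right_inv p := by simp

/-- The action of `F_d` on `Q × F_d`. -/
def act : FreeGroup (Fin d) →* Equiv.Perm (Q × FreeGroup (Fin d)) := FreeGroup.lift (gen π m)

lemma mk_replicate (j : Fin d) (b : Bool) (n : ℕ) :
    mk (List.replicate n (j, b)) = (mk [(j, b)]) ^ n := by
  induction n with
  | zero => simp [← one_eq_mk]
  | succ n ih => rw [List.replicate_succ, pow_succ', ← ih, mul_mk]; rfl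

lemma act_mk (L : List (Fin d × Bool)) (h : FreeGroup (Fin d)) :
    act π m (mk L) (1, h) = (π (mk L), mk (expand π m L) * h) := by
  induction L with
  | nil => simp [← one_eq_mk, expand]
  | cons x L ih =>
    obtain ⟨j, b⟩ := x
    have e : mk ((j, b) :: L) = mk [(j, b)] * mk L := by simp
    rw [e, _root_.map_mul, Equiv.Perm.mul_apply, ih, expand, ← mul_mk, mk_replicate,
      _root_.map_mul]
    cases b
    · have e2 : mk [(j, false)] = (of j)⁻¹ := rfl
      rw [e2, _root_.map_inv, act, lift_apply_of, _root_.map_inv]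
      change (gen π m j).symm _ = _
      simp [gen, edge, mul_assoc]
    · have e2 : mk [(j, true)] = of j := rfl
      rw [e2, act, lift_apply_of]
      simp [gen, edge, mul_assoc]

/-- The stretching map. -/
def stretch (w : FreeGroup (Fin d)) : FreeGroup (Fin d) := mk (expand π m w.toWord)

lemma act_apply (w h : FreeGroup (Fin d)) : act π m w (1, h) = (π w, stretch π m w * h) := by
  have := act_mk π m w.toWord h
  simpa only [mk_toWord, stretch] using this

/-- The stretching homomorphism on the kernel. -/
def stretchHom : π.ker →* FreeGroup (Fin d) where
  toFun w := stretch π m w.1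
  map_one' := by simp [stretch, expand, ← one_eq_mk]
  map_mul' := by
    rintro ⟨w, hw⟩ ⟨v, hv⟩
    have h1 := act_apply π m (w * v) 1
    have hv' : π v = 1 := hv
    rw [_root_.map_mul, Equiv.Perm.mul_apply, act_apply, hv', act_apply] at h1
    have := congrArg Prod.snd h1
    simpa using this.symm

lemma norm_stretch (hm : ∀ e, 1 ≤ m e) (w : FreeGroup (Fin d)) :
    FreeGroup.norm (stretch π m w) = len π m w := by
  rw [stretch, FreeGroup.norm, toWord_mk, (expand_reduced π m hm _ isReduced_toWord).reduce_eq,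
    expand_length, len]

lemma norm_le_len (hm : ∀ e, 1 ≤ m e) (w : FreeGroup (Fin d)) :
    FreeGroup.norm w ≤ len π m w := by
  rw [FreeGroup.norm, len, ← edges_length π]
  generalize edges π w.toWord = l
  induction l with
  | nil => simp
  | cons x l ih => have := hm x; simp; omega

lemma stretchHom_inj (hm : ∀ e, 1 ≤ m e) : Function.Injective (stretchHom π m) := by
  rw [injective_iff_map_eq_one]
  rintro ⟨w, hw⟩ h
  have h1 := norm_stretch π m hm w
  have h2 : stretch π m w = 1 := h
  have h3 := norm_le_len π m hm w
  rw [h2, FreeGroup.norm_one] at h1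
  rw [← h1] at h3
  exact Subtype.ext (norm_eq_zero.1 (Nat.le_zero.1 h3))

lemma growthCount_stretch (hm : ∀ e, 1 ≤ m e) (R : ℕ) :
    growthCount (stretchHom π m).range R =
      Nat.card {w : FreeGroup (Fin d) // π w = 1 ∧ len π m w ≤ R} := by
  symm
  refine Nat.card_eq_of_bijective (fun w => ⟨stretchHom π m ⟨w.1, w.2.1⟩, ⟨_, rfl⟩, ?_⟩) ⟨?_, ?_⟩
  · exact (norm_stretch π m hm w.1).le.trans w.2.2
  · intro w v h
    have h1 := stretchHom_inj π m hm (congrArg Subtype.val h)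
    exact Subtype.ext (Subtype.mk.inj h1)
  · rintro ⟨_, ⟨⟨w, hw⟩, rfl⟩, hR⟩
    exact ⟨⟨w, hw, (norm_stretch π m hm w).ge.trans hR⟩, rfl⟩

lemma finite_len (hm : ∀ e, 1 ≤ m e) (R : ℕ) :
    Finite {w : FreeGroup (Fin d) // π w = 1 ∧ len π m w ≤ R} :=
  Finite.of_injective (β := {w : FreeGroup (Fin d) // FreeGroup.norm w ≤ R})
    (fun w => ⟨w.1, (norm_le_len π m hm w.1).trans w.2.2⟩)
    (fun _ _ h => Subtype.ext (congrArg (fun x => x.1) h))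

lemma fg_stretch [Finite Q] : (stretchHom π m).range.FG := by
  have : Group.FG π.ker := inferInstance
  rw [← Group.fg_iff_subgroup_fg]
  infer_instance

/-! ### Crossings of an edge are sparse -/

lemma edge_gap {g : ℕ} (hπ : ∀ w, FreeGroup.norm w ≤ g → π w = 1 → w = 1)
    (x y : Fin d × Bool) (M S : List (Fin d × Bool)) (h : IsReduced (x :: (M ++ y :: S)))
    (he : edge π x (π (mk (M ++ y :: S))) = edge π y (π (mk S))) : g ≤ M.length := by
  by_contra hlt
  push Not at hlt
  have hsm : ∀ N : List (Fin d × Bool), N <:+: (x :: (M ++ y :: S)) → N.length ≤ g →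
      π (mk N) = 1 → N = [] := by
    intro N hN hl h1
    have h2 := hπ (mk N) (norm_mk_le.trans hl) h1
    have h3 : (mk N).toWord = [] := by rw [h2, toWord_one]
    rwa [toWord_mk, (h.infix hN).reduce_eq] at h3
  have hM : M <:+: (x :: (M ++ y :: S)) := ⟨[x], y :: S, by simp⟩
  have hMy : (M ++ [y]) <:+: (x :: (M ++ y :: S)) := ⟨[x], S, by simp⟩
  have e1 : mk (M ++ y :: S) = mk M * mk [y] * mk S := by simp
  have e3 : mk (M ++ [y]) = mk M * mk [y] := by simp
  obtain ⟨i, b⟩ := x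
  obtain ⟨j, c⟩ := y
  have hij : i = j := by
    have := congrArg Prod.snd he
    unfold edge at this
    split_ifs at this <;> exact this
  subst hij
  have et : mk [(i, true)] = of i := rfl
  have ef : mk [(i, false)] = (of i)⁻¹ := rfl
  have hst := congrArg Prod.fst he
  rw [e1] at hst
  by_cases hbc : b = c
  · subst hbc
    have h1 : π (mk (M ++ [(i, b)])) = 1 := by
      have hst' : π (mk M * mk [(i, b)] * mk S) = π (mk S) := by
        cases b
        · simp only [edge, Bool.false_eq_true, if_false] at hst
          exact mul_left_cancel hst
        · simpa only [edge, if_true] using hst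
      rw [e3]
      rw [_root_.map_mul] at hst'
      exact mul_eq_right.1 hst'
    have := hsm _ hMy (by simpa using hlt) h1
    simp at this
  · have h1 : π (mk M) = 1 := by
      cases b <;> cases c
      · simp at hbc
      · simp only [edge, et, _root_.map_mul] at hst
        simp only [Bool.false_eq_true, if_false, if_true] at hst
        rw [inv_mul_eq_iff_eq_mul, mul_assoc] at hst
        simpa using hst
      · simp only [edge, ef, _root_.map_mul, _root_.map_inv] at hst
        simp only [Bool.false_eq_true, if_false, if_true] at hst
        rw [mul_assoc] at hst
        simpa using hst
      · simp at hbc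
    have h2 := hsm _ hM hlt.le h1
    subst h2
    have := (List.isChain_cons_cons.1 h).1 rfl
    exact hbc this

variable [DecidableEq Q]

lemma first_occ (e : Q × Fin d) (L : List (Fin d × Bool)) (h : e ∈ edges π L) :
    ∃ M y S, L = M ++ y :: S ∧ edge π y (π (mk S)) = e ∧
      (edges π L).count e = (edges π (y :: S)).count e := by
  induction L with
  | nil => simp [edges] at h
  | cons x L ih =>
    by_cases hx : edge π x (π (mk L)) = e
    · exact ⟨[], x, L, rfl, hx, rfl⟩
    · have h' : e ∈ edges π L := by
        simp only [edges, List.mem_cons] at h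
        exact h.resolve_left (fun h => hx h.symm)
      obtain ⟨M, y, S, h1, h2, h3⟩ := ih h'
      refine ⟨x :: M, y, S, by simp [h1], h2, ?_⟩
      rw [← h3, edges, List.count_cons_of_ne hx]

lemma count_le {g : ℕ} (hπ : ∀ w, FreeGroup.norm w ≤ g → π w = 1 → w = 1) (e : Q × Fin d) (n : ℕ) :
    ∀ L : List (Fin d × Bool), L.length ≤ n → IsReduced L →
      (edges π L).count e * g ≤ L.length + g := by
  induction n with
  | zero =>
    intro L hL _
    have : L = [] := by simpa using hL
    subst this
    simp [edges]
  | succ n ih =>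
    intro L hL hr
    cases L with
    | nil => simp [edges]
    | cons x L =>
      simp only [List.length_cons] at hL ⊢
      have hr' : IsReduced L := hr.infix (List.infix_cons (List.infix_refl _))
      by_cases hx : edge π x (π (mk L)) = e
      · rw [edges, hx, List.count_cons_self]
        by_cases hin : e ∈ edges π L
        · obtain ⟨M, y, S, h1, h2, h3⟩ := first_occ π e L hin
          have hg : g ≤ M.length := by
            subst h1
            exact edge_gap π hπ x y M S hr (hx.trans h2.symm)
          rw [h3]
          have hl : L.length = M.length + (y :: S).length := by rw [h1, List.length_append]
          have := ih (y :: S) (by omega) (hr'.infix ⟨M, [], by simp [h1]⟩)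
          rw [add_mul]
          omega
        · rw [List.count_eq_zero_of_not_mem hin]
          omega
      · rw [edges, List.count_cons_of_ne hx]
        have := ih L (by omega) hr'
        omega

/-- The edge weights attached to a multiset of edges. -/
def wt (s : Multiset (Q × Fin d)) (e : Q × Fin d) : ℕ := 1 + s.count e

lemma one_le_wt (s : Multiset (Q × Fin d)) (e : Q × Fin d) : 1 ≤ wt s e := by simp [wt]

lemma len_cons (e : Q × Fin d) (s : Multiset (Q × Fin d)) (w : FreeGroup (Fin d)) :
    len π (wt (e ::ₘ s)) w = len π (wt s) w + (edges π w.toWord).count e := by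
  unfold len
  generalize edges π w.toWord = l
  induction l with
  | nil => simp
  | cons x l ih =>
    simp only [List.map_cons, List.sum_cons, ih, List.count_cons, wt, Multiset.count_cons, beq_iff_eq]
    by_cases h : x = e
    · simp [h]; omega
    · simp [h]; omega

lemma len_cons_le {g : ℕ} (hg : 0 < g) (hπ : ∀ w, FreeGroup.norm w ≤ g → π w = 1 → w = 1)
    (e : Q × Fin d) (s : Multiset (Q × Fin d)) (w : FreeGroup (Fin d)) {R : ℕ}
    (h : len π (wt s) w ≤ R) : len π (wt (e ::ₘ s)) w ≤ R + (R / g + 1) := by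
  rw [len_cons]
  have h1 := count_le π hπ e _ w.toWord le_rfl isReduced_toWord
  have h2 : w.toWord.length ≤ R := (norm_le_len π _ (one_le_wt s) w).trans h
  have h3 : (edges π w.toWord).count e ≤ R / g + 1 := by
    rw [← Nat.add_div_right _ hg, Nat.le_div_iff_mul_le hg]
    omega
  omega

lemma growth_step {g : ℕ} (hg : 0 < g) (hπ : ∀ w, FreeGroup.norm w ≤ g → π w = 1 → w = 1)
    (e : Q × Fin d) (s : Multiset (Q × Fin d)) (R : ℕ) :
    growthCount (stretchHom π (wt s)).range R ≤
      growthCount (stretchHom π (wt (e ::ₘ s))).range (R + (R / g + 1)) := by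
  rw [growthCount_stretch π _ (one_le_wt _), growthCount_stretch π _ (one_le_wt _)]
  have := finite_len π _ (one_le_wt (e ::ₘ s)) (R + (R / g + 1))
  exact Nat.card_le_card_of_injective
    (fun w => ⟨w.1, w.2.1, len_cons_le π hg hπ e s w.1 w.2.2⟩)
    (fun _ _ h => Subtype.ext (congrArg (fun x => x.1) h))

lemma len_const (n : ℕ) (s : Multiset (Q × Fin d)) (hs : ∀ e, wt s e = n)
    (w : FreeGroup (Fin d)) : len π (wt s) w = FreeGroup.norm w * n := by
  rw [FreeGroup.norm, len, ← edges_length π]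
  generalize edges π w.toWord = l
  induction l with
  | nil => simp
  | cons x l ih => simp [ih, hs]; ring

lemma growth_last (n : ℕ) (hn : 0 < n) (s : Multiset (Q × Fin d)) (hs : ∀ e, wt s e = n) (R : ℕ) :
    growthCount (stretchHom π (wt s)).range R ≤ (2 * d + 1) ^ (R / n) := by
  rw [growthCount_stretch π _ (one_le_wt _)]
  refine le_trans ?_ (ball_card_le (R / n))
  refine Nat.card_le_card_of_injective
    (fun w => ⟨w.1, ?_⟩)
    (fun _ _ h => Subtype.ext (congrArg (fun x => x.1) h))
  have := w.2.2
  rw [len_const π n s hs] at this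
  exact (Nat.le_div_iff_mul_le hn).2 this

lemma growth_first [Finite Q] (hd : 2 ≤ d) : ∃ D : ℕ, ∀ R, (2 * d - 1) ^ R ≤
    Nat.card Q * growthCount (stretchHom π (wt 0)).range (R + D) := by
  classical
  have hrep : ∀ q : Q, ∃ v : FreeGroup (Fin d), (∃ w, π w = q) → π v = q := by
    intro q
    by_cases h : ∃ w, π w = q
    · exact ⟨h.choose, fun _ => h.choose_spec⟩
    · exact ⟨1, fun h' => absurd h' h⟩
  choose v hv using hrep
  have hfin : (Set.range (fun q => FreeGroup.norm (v q))).Finite := Set.finite_range _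
  obtain ⟨D, hD⟩ := hfin.bddAbove
  refine ⟨D, fun R => (ball_card_ge hd R).trans ?_⟩
  have hlen : ∀ w : FreeGroup (Fin d), len π (wt 0) w = FreeGroup.norm w := by
    intro w
    rw [len_const π 1 0 (by simp [wt]), mul_one]
  rw [growthCount_stretch π _ (one_le_wt _), ← Nat.card_prod]
  have := finite_len π _ (one_le_wt (0 : Multiset (Q × Fin d))) (R + D)
  refine Nat.card_le_card_of_injective
    (fun w => (π w.1, ⟨w.1 * (v (π w.1))⁻¹, ?_, ?_⟩)) ?_
  · rw [_root_.map_mul, _root_.map_inv, hv _ ⟨_, rfl⟩, mul_inv_cancel]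
  · rw [hlen]
    refine (FreeGroup.norm_mul_le _ _).trans (add_le_add w.2 ?_)
    rw [norm_inv_eq]
    exact hD ⟨_, rfl⟩
  · rintro ⟨w, hw⟩ ⟨u, hu⟩ h
    have h1 := congrArg Prod.fst h
    have h2 := congrArg (fun x => x.2.1) h
    simp only at h1 h2
    rw [h1] at h2
    exact Subtype.ext (mul_right_cancel h2)

end Stretch

/-! ### Exponents -/

lemma growthCount_pos (H : Subgroup (FreeGroup (Fin d))) (R : ℕ) : 1 ≤ growthCount H R := by
  have : Finite {g : FreeGroup (Fin d) // g ∈ H ∧ FreeGroup.norm g ≤ R} :=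
    Finite.of_injective (β := {w : FreeGroup (Fin d) // FreeGroup.norm w ≤ R})
      (fun w => ⟨w.1, w.2.2⟩) (fun _ _ h => Subtype.ext (congrArg (fun x => x.1) h))
  have : Nonempty {g : FreeGroup (Fin d) // g ∈ H ∧ FreeGroup.norm g ≤ R} :=
    ⟨⟨1, H.one_mem, by simp⟩⟩
  exact Nat.card_pos

lemma growthCount_le (H : Subgroup (FreeGroup (Fin d))) (R : ℕ) :
    growthCount H R ≤ (2 * d + 1) ^ R :=
  (Nat.card_le_card_of_injective (β := {w : FreeGroup (Fin d) // FreeGroup.norm w ≤ R})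
    (fun w => ⟨w.1, w.2.2⟩) (fun _ _ h => Subtype.ext (congrArg (fun x => x.1) h))).trans
    (ball_card_le R)

lemma ratio_nonneg (H : Subgroup (FreeGroup (Fin d))) (R : ℕ) :
    0 ≤ Real.log (growthCount H R : ℝ) / (R : ℝ) := by
  have : (1 : ℝ) ≤ growthCount H R := by exact_mod_cast growthCount_pos H R
  have := Real.log_nonneg this
  positivity

lemma ratio_le_of (H : Subgroup (FreeGroup (Fin d))) (n R : ℕ) (hn : 0 < n)
    (h : growthCount H R ≤ (2 * d + 1) ^ (R / n)) :
    Real.log (growthCount H R : ℝ) / (R : ℝ) ≤ Real.log (2 * d + 1) / n := by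
  have h1 : (0 : ℝ) < growthCount H R := by exact_mod_cast growthCount_pos H R
  have h2 : (growthCount H R : ℝ) ≤ (2 * d + 1 : ℝ) ^ (R / n) := by exact_mod_cast h
  have h3 := Real.log_le_log h1 h2
  rw [Real.log_pow] at h3
  have h4 : ((R / n : ℕ) : ℝ) ≤ (R : ℝ) / n := Nat.cast_div_le
  have h5 : 0 ≤ Real.log (2 * d + 1 : ℝ) := Real.log_nonneg (by
    have : (0 : ℝ) ≤ d := by positivity
    linarith)
  have hn' : (0 : ℝ) < n := by exact_mod_cast hn
  rcases Nat.eq_zero_or_pos R with rfl | hR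
  · simp; positivity
  · have hR' : (0 : ℝ) < R := by exact_mod_cast hR
    rw [div_le_div_iff₀ hR' hn']
    calc _ ≤ ((R : ℝ) / n * Real.log (2 * d + 1 : ℝ)) * n := by
            gcongr
            exact h3.trans (by gcongr)
      _ = _ := by field_simp

lemma isBdd (H : Subgroup (FreeGroup (Fin d))) :
    IsBoundedUnder (· ≤ ·) atTop
      (fun R : ℕ => Real.log (growthCount H R : ℝ) / (R : ℝ)) :=
  isBoundedUnder_of ⟨_, fun R => ratio_le_of H 1 R one_pos (by simpa using growthCount_le H R)⟩

lemma isCobdd (H : Subgroup (FreeGroup (Fin d))) :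
    IsCoboundedUnder (· ≤ ·) atTop
      (fun R : ℕ => Real.log (growthCount H R : ℝ) / (R : ℝ)) :=
  (isBoundedUnder_of ⟨0, fun R => ratio_nonneg H R⟩ :
    IsBoundedUnder (· ≥ ·) atTop _).isCoboundedUnder_le

lemma critExp_nonneg (H : Subgroup (FreeGroup (Fin d))) : 0 ≤ critExp H :=
  le_limsup_of_frequently_le (Frequently.of_forall fun R => ratio_nonneg H R) (isBdd H)

lemma compare (H : Subgroup (FreeGroup (Fin d))) (L : ℕ → ℝ) (κ A B : ℝ) (hκ : 0 < κ)
    (h : ∀ R : ℕ, ∃ R' : ℕ, R ≤ R' ∧ (R' : ℝ) ≤ κ * R + B ∧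
      L R ≤ A + Real.log (growthCount H R' : ℝ)) (η : ℝ) (hη : κ * critExp H < η) :
    ∀ᶠ R : ℕ in atTop, L R / R ≤ η := by
  obtain ⟨s, hs1, hs2⟩ : ∃ s, critExp H < s ∧ κ * s < η := by
    have : critExp H < η / κ := by rwa [lt_div_iff₀' hκ]
    obtain ⟨s, h1, h2⟩ := exists_between this
    exact ⟨s, h1, by rwa [lt_div_iff₀' hκ] at h2⟩
  have hs0 : 0 ≤ s := (critExp_nonneg H).trans hs1.le
  have h1 : ∀ᶠ R : ℕ in atTop, Real.log (growthCount H R : ℝ) / (R : ℝ) < s :=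
    eventually_lt_of_limsup_lt hs1 (isBdd H)
  obtain ⟨N, hN⟩ := eventually_atTop.1 h1
  have h2 : Tendsto (fun R : ℕ => (A + s * B) / (R : ℝ)) atTop (nhds 0) :=
    tendsto_const_div_atTop_nhds_zero_nat _
  have h3 : ∀ᶠ R : ℕ in atTop, (A + s * B) / (R : ℝ) < η - κ * s :=
    h2.eventually_lt_const (by linarith)
  filter_upwards [h3, eventually_ge_atTop N, eventually_gt_atTop 0] with R hR3 hRN hR0
  obtain ⟨R', hR1, hR2, hR4⟩ := h R
  have h4 := hN R' (hRN.trans hR1)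
  have hR'0 : (0 : ℝ) < R' := by exact_mod_cast hR0.trans_le hR1
  have hR0' : (0 : ℝ) < R := by exact_mod_cast hR0
  rw [div_lt_iff₀ hR'0] at h4
  rw [div_lt_iff₀ hR0'] at hR3
  rw [div_le_iff₀ hR0']
  have h5 : s * R' ≤ s * (κ * R + B) := mul_le_mul_of_nonneg_left hR2 hs0
  nlinarith

lemma critExp_step {Q : Type} [Group Q] [DecidableEq Q] (π : FreeGroup (Fin d) →* Q)
    {g : ℕ} (hg : 0 < g) (hπ : ∀ w, FreeGroup.norm w ≤ g → π w = 1 → w = 1)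
    (e : Q × Fin d) (s : Multiset (Q × Fin d)) :
    critExp (stretchHom π (wt s)).range ≤
      (1 + 1 / (g : ℝ)) * critExp (stretchHom π (wt (e ::ₘ s))).range := by
  have hg' : (0 : ℝ) < g := by exact_mod_cast hg
  apply le_of_forall_gt_imp_ge_of_dense
  intro η hη
  refine limsup_le_of_le (isCobdd _) ?_
  refine compare (stretchHom π (wt (e ::ₘ s))).range
    (fun R => Real.log (growthCount (stretchHom π (wt s)).range R : ℝ))
    (1 + 1 / (g : ℝ)) 0 1 (by positivity) ?_ η hη
  intro R
  refine ⟨R + (R / g + 1), Nat.le_add_right _ _, ?_, ?_⟩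
  · push_cast
    have : ((R / g : ℕ) : ℝ) ≤ (R : ℝ) / g := Nat.cast_div_le
    have e : (1 + 1 / (g : ℝ)) * R + 1 = R + (R / g + 1) := by field_simp; ring
    rw [e]
    linarith
  · rw [zero_add]
    apply Real.log_le_log
    · exact_mod_cast growthCount_pos _ R
    · exact_mod_cast growth_step π hg hπ e s R

lemma critExp_first {Q : Type} [Group Q] [Finite Q] [DecidableEq Q] (π : FreeGroup (Fin d) →* Q)
    (hd : 2 ≤ d) : Real.log (2 * d - 1) ≤ critExp (stretchHom π (wt 0)).range := by
  obtain ⟨D, hD⟩ := growth_first π hd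
  apply le_of_forall_gt_imp_ge_of_dense
  intro η hη
  have hev := compare (stretchHom π (wt 0)).range (fun R => R * Real.log (2 * d - 1)) 1
    (Real.log (Nat.card Q)) D one_pos (by
      intro R
      refine ⟨R + D, by omega, by push_cast; linarith, ?_⟩
      have h1 : ((2 * d - 1 : ℕ) : ℝ) = 2 * d - 1 := by
        rw [Nat.cast_sub (by omega)]; push_cast; ring
      have hQ : (Nat.card Q : ℝ) ≠ 0 := by exact_mod_cast Nat.card_pos.ne'
      have hc : (growthCount (stretchHom π (wt 0)).range (R + D) : ℝ) ≠ 0 := by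
        exact_mod_cast (Nat.one_le_iff_ne_zero.1 (growthCount_pos _ _))
      rw [← Real.log_mul hQ hc, ← Real.log_pow, ← h1]
      apply Real.log_le_log
      · have : 0 < (2 * d - 1) ^ R := pow_pos (by omega) R
        exact_mod_cast this
      · exact_mod_cast hD R) η (by simpa using hη)
  obtain ⟨R, hR, hR0⟩ := (hev.and (eventually_gt_atTop 0)).exists
  have hR0' : (R : ℝ) ≠ 0 := by exact_mod_cast hR0.ne'
  rwa [mul_div_cancel_left₀ _ hR0'] at hR

lemma critExp_last {Q : Type} [Group Q] [DecidableEq Q] (π : FreeGroup (Fin d) →* Q)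
    (n : ℕ) (hn : 0 < n) (s : Multiset (Q × Fin d)) (hs : ∀ e, wt s e = n) :
    critExp (stretchHom π (wt s)).range ≤ Real.log (2 * d + 1) / n :=
  limsup_le_of_le (isCobdd _) (Eventually.of_forall fun R =>
    ratio_le_of _ n R hn (growth_last π n hn s hs R))

lemma approx (hd : 2 ≤ d) (t : ℝ) (ht : 0 < t) (ht' : t ≤ Real.log (2 * d - 1)) (g : ℕ)
    (hg : 0 < g) : ∃ H : Subgroup (FreeGroup (Fin d)), H.FG ∧ critExp H ≤ t ∧
      t ≤ (1 + 1 / (g : ℝ)) * critExp H := by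
  classical
  by_contra hno
  push Not at hno
  obtain ⟨B, hB, π, hπ⟩ := exists_quotient d g
  have hg' : (0 : ℝ) < g := by exact_mod_cast hg
  have := Fintype.ofFinite B
  have all : ∀ s : Multiset (Equiv.Perm B × Fin d),
      t < critExp (stretchHom π (wt s)).range := by
    intro s
    induction s using Multiset.induction with
    | empty =>
      by_contra hlt
      push Not at hlt
      have h1 := hno _ (fg_stretch π (wt 0)) hlt
      have h2 := critExp_first π hd
      have h3 := critExp_nonneg (stretchHom π (wt 0)).range
      have h4 : 0 ≤ 1 / (g : ℝ) * critExp (stretchHom π (wt 0)).range := by positivity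
      linarith
    | cons e s ih =>
      by_contra hlt
      push Not at hlt
      have h1 := hno _ (fg_stretch π _) hlt
      have h2 := critExp_step π hg hπ e s
      linarith
  obtain ⟨n, hn⟩ := exists_nat_gt (Real.log (2 * d + 1) / t)
  have hfin := critExp_last π (n + 1) (by omega)
    (n • (Finset.univ : Finset (Equiv.Perm B × Fin d)).val) (by
      intro e
      rw [wt, Multiset.count_nsmul, Multiset.count_eq_one_of_mem Finset.univ.nodup
        (Finset.mem_univ_val e)]
      omega)
  have h1 := all (n • (Finset.univ : Finset (Equiv.Perm B × Fin d)).val)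
  have h2 := h1.trans_le hfin
  rw [lt_div_iff₀ (by positivity)] at h2
  rw [div_lt_iff₀ ht] at hn
  push_cast at h2
  linarith

end CritDense

theorem fg_critExp_dense (d : ℕ) (hd : 2 ≤ d) :
    Set.Icc (0 : ℝ) (Real.log (2 * (d : ℝ) - 1)) ⊆
      closure {x : ℝ | ∃ H : Subgroup (FreeGroup (Fin d)), H.FG ∧ critExp H = x} := by
  have hd' : (2 : ℝ) ≤ d := by exact_mod_cast hd
  have hpos : 0 < Real.log (2 * (d : ℝ) - 1) := Real.log_pos (by linarith)
  rw [← closure_Ioc hpos.ne]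
  refine closure_minimal ?_ isClosed_closure
  rintro t ⟨ht, ht'⟩
  rw [Metric.mem_closure_iff]
  intro ε hε
  obtain ⟨g, hg⟩ := exists_nat_gt (t / ε)
  have hg0 : (0 : ℝ) < g := lt_trans (by positivity) hg
  obtain ⟨H, hH, h1, h2⟩ := CritDense.approx hd t ht ht' g (by exact_mod_cast hg0)
  refine ⟨_, ⟨H, hH, rfl⟩, ?_⟩
  rw [Real.dist_eq, abs_of_nonneg (by linarith)]
  rw [div_lt_iff₀ hε] at hg
  have h3 : 1 / (g : ℝ) * critExp H ≤ 1 / (g : ℝ) * t := by gcongr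
  have h4 : 1 / (g : ℝ) * t < ε := by
    rw [one_div, inv_mul_lt_iff₀ hg0]; exact hg
  linarith
end
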